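/- arXiv:2510.00854 — 3 statements merged into one kernel-verified Lean document; each statement's English description precedes it below -/
import Mathlib

section
/- Let T be a satisfiable first-order theory in a language L. Then T is stable if and only if there exists an infinite cardinal κ with L.card ≤ κ such that T is κ-stable, i.e. such that for every model M of T of cardinality at most κ, the set of complete 1-types over M has cardinality at most κ. -/
open FirstOrder FirstOrder.Language Cardinal

universe u v

variable {L : FirstOrder.Language.{u, v}}

/-- An `L`-formula `φ` with free variables in `Fin m ⊕ Fin n` has the order property in an
`L`-structure `M` if there are sequences `a : ℕ → (Fin m → M)` and `b : ℕ → (Fin n → M)`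
such that `φ(a i, b j)` holds iff `i ≤ j`. -/
def HasOrderProperty {m n : ℕ} (φ : L.Formula (Fin m ⊕ Fin n))
    (M : Type w) [L.Structure M] : Prop :=
  ∃ (a : ℕ → Fin m → M) (b : ℕ → Fin n → M),
    ∀ i j : ℕ, φ.Realize (Sum.elim (a i) (b j)) ↔ i ≤ j

/-- A satisfiable `L`-theory `T` is stable if no `L`-formula has the order property in any
model of `T`. -/
def IsStableTheory (T : L.Theory) : Prop :=
  ∀ (m n : ℕ) (φ : L.Formula (Fin m ⊕ Fin n)) (M : Theory.ModelType.{u, v, max u v} T),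
    ¬ HasOrderProperty φ M

/-- For an infinite cardinal `κ`, a theory `T` is `κ`-stable if every model `M` of `T` with
at most `κ` elements has at most `κ` complete 1-types over it, a complete 1-type over `M`
being a complete type of the elementary diagram of `M` in one free variable. -/
def IsKappaStable (T : L.Theory) (κ : Cardinal.{max u v}) : Prop :=
  ∀ (M : Type max u v) [L.Structure M] [Nonempty M], M ⊨ T → #M ≤ κ →
    #((L.elementaryDiagram M).CompleteType (Fin 1)) ≤ κ

namespace StabProof
open Filter

/-- The sentence with constants associated to an `L`-formula with parameters in `M`. -/
noncomputable def sent {M : Type*} [L.Structure M] (ψ : L.Formula (M ⊕ Fin 1)) :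
    L[[M]][[Fin 1]].Sentence :=
  Formula.equivSentence (BoundedFormula.constantsVarsEquiv.symm ψ)

theorem sent_surj {M : Type*} [L.Structure M] (σ : L[[M]][[Fin 1]].Sentence) :
    ∃ ψ : L.Formula (M ⊕ Fin 1), sent ψ = σ :=
  ⟨BoundedFormula.constantsVarsEquiv (Formula.equivSentence.symm σ), by simp [sent]⟩

theorem type_ext {M : Type*} [L.Structure M]
    (p q : (L.elementaryDiagram M).CompleteType (Fin 1))
    (h : ∀ ψ : L.Formula (M ⊕ Fin 1), sent ψ ∈ p ↔ sent ψ ∈ q) : p = q := by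
  refine SetLike.ext fun σ => ?_
  obtain ⟨ψ, rfl⟩ := sent_surj σ
  exact h ψ

theorem type_realized (M : Type max u v) [L.Structure M]
    (p : (L.elementaryDiagram M).CompleteType (Fin 1)) :
    ∃ (N : Type max u v) (_ : L.Structure N) (f : M ↪ₑ[L] N) (c : Fin 1 → N),
      ∀ ψ : L.Formula (M ⊕ Fin 1), sent ψ ∈ p ↔ ψ.Realize (Sum.elim f c) := by
  obtain ⟨N, c, rfl⟩ := Theory.exists_modelType_is_realized_in _ p
  let _ : L.Structure N := (L.lhomWithConstants M).reduct N
  refine ⟨N, inferInstance, ElementaryEmbedding.ofModelsElementaryDiagram L M N, c, fun ψ => ?_⟩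
  unfold sent
  rw [Theory.CompleteType.formula_mem_typeOf]
  unfold Formula.Realize
  rw [← BoundedFormula.realize_constantsVarsEquiv, Equiv.apply_symm_apply]
  rfl

theorem type_exists (M : Type max u v) [L.Structure M] [Nonempty M]
    (q : Set (L.Formula (M ⊕ Fin 1)))
    (hq : ∀ s : Finset (L.Formula (M ⊕ Fin 1)), ↑s ⊆ q →
      ∃ e : Fin 1 → M, ∀ ψ ∈ s, ψ.Realize (Sum.elim id e)) :
    ∃ p : (L.elementaryDiagram M).CompleteType (Fin 1), ∀ ψ ∈ q, sent ψ ∈ p := by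
  classical
  have := Theory.CompleteType.setOfPred_subset_eq_empty_iff (T := L.elementaryDiagram M)
    (α := Fin 1) (sent '' q)
  rw [← not_iff_not, not_not, ← ne_eq, ← Set.nonempty_iff_ne_empty] at this
  obtain ⟨p, hp⟩ := this.2 (by
    rw [Theory.isSatisfiable_iff_isFinitelySatisfiable]
    intro T0 hT0
    obtain ⟨s, hs, hs'⟩ : ∃ s : Finset (L.Formula (M ⊕ Fin 1)), ↑s ⊆ q ∧
        (↑T0 ⊆ ((L[[M]].lhomWithConstants (Fin 1)).onTheory (L.elementaryDiagram M)) ∪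
          sent '' (s : Set _)) := by
      obtain ⟨s, hs, hs'⟩ := Finset.subset_set_image_iff.1
        (show ((T0.filter (· ∈ sent '' q) : Finset _) : Set _) ⊆ sent '' q by
          intro x hx; exact (Finset.mem_filter.1 hx).2)
      refine ⟨s, hs, fun x hx => ?_⟩
      rcases hT0 hx with h | h
      · exact Or.inl h
      · right
        rw [← Finset.coe_image, hs']
        exact Finset.mem_filter.2 ⟨hx, h⟩
    obtain ⟨e, he⟩ := hq s hs
    let p := (L.elementaryDiagram M).typeOf e
    refine p.isMaximal.1.mono (hs'.trans (Set.union_subset p.subset ?_))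
    rintro _ ⟨ψ, hψ, rfl⟩
    show sent ψ ∈ p
    unfold sent
    rw [Theory.CompleteType.formula_mem_typeOf]
    unfold Formula.Realize
    rw [← BoundedFormula.realize_constantsVarsEquiv, Equiv.apply_symm_apply]
    exact he ψ hψ)
  exact ⟨p, fun ψ hψ => hp ⟨ψ, hψ, rfl⟩⟩

theorem ramsey (r : ℕ → ℕ → Prop) : ∃ f : ℕ → ℕ, StrictMono f ∧
    ((∀ i j, i < j → r (f i) (f j)) ∨ (∀ i j, i < j → ¬ r (f i) (f j))) := by
  let U := hyperfilter ℕ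
  obtain ⟨Q, hQ⟩ : ∃ Q : Prop, ∀ᶠ i in U, ((∀ᶠ n in U, r i n) ↔ Q) := by
    by_cases h : ∀ᶠ i in U, (∀ᶠ n in U, r i n)
    · exact ⟨True, by simpa using h⟩
    · exact ⟨False, by simpa [← Ultrafilter.eventually_not] using h⟩
  obtain ⟨f, -, hf⟩ := exists_seq_of_forall_finset_exists
    (fun i => ((∀ᶠ n in U, r i n) ↔ Q)) (fun i j => i < j ∧ (r i j ↔ Q)) (by
      intro s hs
      have : ∀ᶠ y in U, ((∀ᶠ n in U, r y n) ↔ Q) ∧ ∀ x ∈ s, x < y ∧ (r x y ↔ Q) := by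
        refine hQ.and ((Filter.eventually_all_finset s).2 fun x hx => ?_)
        refine Filter.Eventually.and ?_ ?_
        · have : ∀ᶠ y in cofinite, x < y := by
            rw [Nat.cofinite_eq_atTop]; exact eventually_gt_atTop x
          exact hyperfilter_le_cofinite this
        · have := hs x hx
          by_cases h : Q
          · simpa [h] using this
          · simpa [h, ← Ultrafilter.eventually_not] using this
      exact this.exists)
  refine ⟨f, fun i j h => (hf i j h).1, ?_⟩
  by_cases h : Q
  · left; intro i j hij; simpa [h] using (hf i j hij).2
  · right; intro i j hij; simpa [h] using (hf i j hij).2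

theorem elem_descend {M N : Type*} [L.Structure M] [L.Structure N] (f : M ↪ₑ[L] N) (c : Fin 1 → N)
    (ψ : L.Formula (M ⊕ Fin 1)) (h : ψ.Realize (Sum.elim f c)) :
    ∃ a : Fin 1 → M, ψ.Realize (Sum.elim id a) := by
  have h1 : (ψ.iExs (Fin 1)).Realize (f ∘ id) := Formula.realize_iExs.2 ⟨c, h⟩
  rw [f.map_formula] at h1
  exact Formula.realize_iExs.1 h1

theorem local_def {X Y : Type*} (φ : X → Y → Prop) (S : Set Y)
    (hS : ∀ B : Finset Y, ∃ a, ∀ b ∈ B, (φ a b ↔ b ∈ S))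
    (h1 : ¬ ∃ (a : ℕ → X) (b : ℕ → Y), ∀ i j, φ (a i) (b j) ↔ i ≤ j)
    (h2 : ¬ ∃ (b : ℕ → Y) (a : ℕ → X), ∀ i j, φ (a j) (b i) ↔ i ≤ j) :
    ∃ F : Finset X, ∀ b b', (∀ a ∈ F, (φ a b ↔ φ a b')) → b ∈ S → b' ∈ S := by
  classical
  by_contra hF
  push Not at hF
  obtain ⟨t, ht, hr⟩ := exists_seq_of_forall_finset_exists
    (fun t : X × Y × Y => t.2.1 ∈ S ∧ t.2.2 ∉ S ∧ φ t.1 t.2.1 ∧ ¬ φ t.1 t.2.2)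
    (fun s t => (φ s.1 t.2.1 ↔ φ s.1 t.2.2) ∧ φ t.1 s.2.1 ∧ ¬ φ t.1 s.2.2) (by
      intro s hs
      obtain ⟨b, b', hb, hbS, hbS'⟩ := hF (s.image (·.1))
      obtain ⟨a, ha⟩ := hS ({b, b'} ∪ s.image (·.2.1) ∪ s.image (·.2.2))
      refine ⟨(a, b, b'), ⟨hbS, hbS', (ha b (by simp)).2 hbS,
        fun h => hbS' ((ha b' (by simp)).1 h)⟩, fun x hx => ⟨?_, ?_, ?_⟩⟩
      · exact hb x.1 (Finset.mem_image_of_mem _ hx)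
      · refine (ha _ ?_).2 (hs x hx).1
        simp only [Finset.mem_union]
        exact Or.inl (Or.inr (Finset.mem_image_of_mem (fun y : X × Y × Y => y.2.1) hx))
      · refine fun h => (hs x hx).2.1 ((ha _ ?_).1 h)
        simp only [Finset.mem_union]
        exact Or.inr (Finset.mem_image_of_mem (fun y : X × Y × Y => y.2.2) hx))
  obtain ⟨f, hf, hc⟩ := ramsey (fun i j => φ (t i).1 (t j).2.1)
  rcases hc with hc | hc
  · refine h1 ⟨fun i => (t (f i)).1, fun j => (t (f (j+1))).2.2, fun i j => ?_⟩
    constructor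
    · intro h
      by_contra hij
      push Not at hij
      rcases (show j + 1 ≤ i from hij).eq_or_lt with h' | h'
      · subst h'; exact (ht _).2.2.2 h
      · exact (hr _ _ (hf h')).2.2 h
    · intro h
      have h' : i < j + 1 := by omega
      exact (hr _ _ (hf h')).1.1 (hc _ _ h')
  · refine h2 ⟨fun i => (t (f i)).2.1, fun j => (t (f j)).1, fun i j => ?_⟩
    constructor
    · intro h
      by_contra hij
      push Not at hij
      exact hc _ _ hij h
    · intro h
      rcases h.eq_or_lt with h' | h'
      · rw [h']; exact (ht _).2.2.1
      · exact (hr _ _ (hf h')).2.1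

open Classical in
theorem local_code {X Y : Type*} (φ : X → Y → Prop) (S : Set Y)
    (hS : ∀ B : Finset Y, ∃ a, ∀ b ∈ B, (φ a b ↔ b ∈ S))
    (h1 : ¬ ∃ (a : ℕ → X) (b : ℕ → Y), ∀ i j, φ (a i) (b j) ↔ i ≤ j)
    (h2 : ¬ ∃ (b : ℕ → Y) (a : ℕ → X), ∀ i j, φ (a j) (b i) ↔ i ≤ j) :
    ∃ C : Finset X × Finset (Finset X), ∀ b, b ∈ S ↔ (C.1.filter (fun a => φ a b)) ∈ C.2 := by
  obtain ⟨F, hF⟩ := local_def φ S hS h1 h2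
  refine ⟨(F, F.powerset.filter (fun G => ∃ b ∈ S, G = F.filter (fun a => φ a b))), fun b => ?_⟩
  simp only [Finset.mem_filter, Finset.mem_powerset, Finset.filter_subset, true_and]
  constructor
  · intro h; exact ⟨b, h, rfl⟩
  · rintro ⟨b', hb', h⟩
    refine hF b' b (fun a ha => ?_) hb'
    have := Finset.ext_iff.1 h a
    simp only [Finset.mem_filter, ha, true_and] at this
    exact this.symm

theorem finset_card_le {X : Type*} {κ : Cardinal} (h0 : ℵ₀ ≤ κ) (h : #X ≤ κ) :
    #(Finset X) ≤ κ := by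
  classical
  have : Function.Injective (Finset.toList : Finset X → List X) := fun a b h => by
    rw [← Finset.toList_toFinset (s := a) , h, Finset.toList_toFinset]
  exact (mk_le_of_injective this).trans ((mk_list_le_max X).trans (max_le h0 h))

theorem fin_vars {M : Type*} (ψ : L.Formula (M ⊕ Fin 1)) :
    ∃ (n : ℕ) (φ : L.Formula (Fin 1 ⊕ Fin n)) (b : Fin n → M),
      ∀ (N : Type max u v) [L.Structure N] (f : M → N) (c : Fin 1 → N),
        ψ.Realize (Sum.elim f c) ↔ φ.Realize (Sum.elim c (f ∘ b)) := by
  classical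
  -- the parameters of `M` occurring in `ψ`
  let P : Finset M := ψ.freeVarFinset.biUnion (fun x => Sum.elim (fun m => {m}) (fun _ => ∅) x)
  let e := P.equivFin
  let g : ψ.freeVarFinset → Fin 1 ⊕ Fin P.card := fun x =>
    match x with
    | ⟨.inl m, hm⟩ => .inr (e ⟨m, Finset.mem_biUnion.2 ⟨.inl m, hm, by simp⟩⟩)
    | ⟨.inr i, _⟩ => .inl i
  refine ⟨P.card, BoundedFormula.restrictFreeVar ψ g, fun i => (e.symm i : M), ?_⟩
  intro N _ f c
  unfold Formula.Realize
  rw [BoundedFormula.realize_restrictFreeVar (Sum.elim f c)]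
  rintro ⟨m | i, h⟩ <;> simp [g]

theorem formulas_card_le {κ : Cardinal.{max u v}} (h0 : ℵ₀ ≤ κ) (hL : L.card ≤ κ) :
    #(Σ n : ℕ, L.Formula (Fin 1 ⊕ Fin n)) ≤ κ := by
  rw [mk_sigma]
  refine (sum_le_lift_mk_mul_iSup _).trans ?_
  refine mul_le_of_le h0 (by simpa using h0) (ciSup_le' fun n => ?_)
  have h : Function.Injective (fun φ : L.Formula (Fin 1 ⊕ Fin n) =>
      (⟨0, φ⟩ : Σ k, L.BoundedFormula (Fin 1 ⊕ Fin n) k)) := fun a b h => by simpa using h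
  refine (mk_le_of_injective h).trans (BoundedFormula.card_le.trans (max_le h0 ?_))
  refine add_le_of_le h0 ?_ (by simpa using hL)
  exact le_trans (by simp) h0

theorem forward (T : L.Theory) (h : IsStableTheory T) :
    ∃ κ : Cardinal.{max u v}, ℵ₀ ≤ κ ∧ L.card ≤ κ ∧ IsKappaStable T κ := by
  classical
  let μ : Cardinal.{max u v} := max ℵ₀ L.card
  have hμ : ℵ₀ ≤ μ := le_max_left _ _
  have hμκ : μ ≤ 2 ^ μ := (cantor μ).le
  have h0 : ℵ₀ ≤ (2 : Cardinal.{max u v}) ^ μ := hμ.trans hμκ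
  refine ⟨2 ^ μ, h0, (le_max_right _ _).trans hμκ, ?_⟩
  intro M _ _ hM hcard
  have hno : ∀ (m n : ℕ) (φ : L.Formula (Fin m ⊕ Fin n)), ¬ HasOrderProperty φ M := fun m n φ =>
    h m n φ (Theory.ModelType.of T M)
  have key : ∀ (p : (L.elementaryDiagram M).CompleteType (Fin 1))
      (x : Σ n : ℕ, L.Formula (Fin 1 ⊕ Fin n)),
      ∃ C : Finset (Fin 1 → M) × Finset (Finset (Fin 1 → M)),
        ∀ b : Fin x.1 → M, sent (x.2.relabel (Sum.elim Sum.inr (Sum.inl ∘ b))) ∈ p ↔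
          (C.1.filter (fun a => x.2.Realize (Sum.elim a b))) ∈ C.2 := by
    rintro p ⟨n, φ⟩
    obtain ⟨N, _, f, c, hp⟩ := type_realized M p
    have rel : ∀ (K : Type max u v) [L.Structure K] (f : M → K) (c : Fin 1 → K) (b : Fin n → M),
        (φ.relabel (Sum.elim Sum.inr (Sum.inl ∘ b)) : L.Formula (M ⊕ Fin 1)).Realize (Sum.elim f c)
          ↔ φ.Realize (Sum.elim c (f ∘ b)) := by
      intro K _ f c b
      rw [Formula.realize_relabel]
      apply iff_of_eq; congr 1
      ext (i | i) <;> simp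
    refine local_code (fun (a : Fin 1 → M) b => φ.Realize (Sum.elim a b))
      {b | sent (φ.relabel (Sum.elim Sum.inr (Sum.inl ∘ b))) ∈ p} (fun B => ?_) (hno 1 n φ) ?_
    · let lit : B → L.Formula (M ⊕ Fin 1) := fun b =>
        let ψ := φ.relabel (Sum.elim Sum.inr (Sum.inl ∘ b.1))
        if sent ψ ∈ p then ψ else ψ.not
      obtain ⟨a, ha⟩ := elem_descend f c (Formula.iInf lit) (by
        rw [Formula.realize_iInf]
        intro b
        simp only [lit]
        split_ifs with hb
        · exact (hp _).1 hb
        · rw [Formula.realize_not, ← hp]; exact hb)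
      refine ⟨a, fun b hb => ?_⟩
      rw [Formula.realize_iInf] at ha
      have := ha ⟨b, hb⟩
      simp only [lit] at this
      show _ ↔ sent _ ∈ p
      split_ifs at this with hb
      · simpa [hb] using (rel _ _ _ _).1 this
      · rw [Formula.realize_not, rel] at this
        simpa [hb] using this
    · have := hno n 1 (φ.relabel Sum.swap)
      rintro ⟨b, a, hab⟩
      refine this ⟨b, a, fun i j => ?_⟩
      rw [Formula.realize_relabel, ← hab]
      apply iff_of_eq; congr 1
      ext (i | i) <;> simp
  choose code hcode using key
  have inj : Function.Injective code := by
    intro p q hpq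
    refine type_ext _ _ fun ψ => ?_
    obtain ⟨n, φ, b, hφ⟩ := fin_vars ψ
    have tr : ∀ p : (L.elementaryDiagram M).CompleteType (Fin 1),
        sent ψ ∈ p ↔ sent (φ.relabel (Sum.elim Sum.inr (Sum.inl ∘ b))) ∈ p := by
      intro p
      obtain ⟨N, _, f, c, hp⟩ := type_realized M p
      rw [hp, hp, hφ, Formula.realize_relabel]
      apply iff_of_eq; congr 1
      ext (i | i) <;> simp
    rw [tr, tr, hcode p ⟨n, φ⟩ b, hcode q ⟨n, φ⟩ b, hpq]
  refine (mk_le_of_injective inj).trans ?_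
  rw [mk_pi, prod_const, lift_id, lift_id]
  have hX : #(Fin 1 → M) ≤ 2 ^ μ := by simpa using hcard
  have hC : #(Finset (Fin 1 → M) × Finset (Finset (Fin 1 → M))) ≤ 2 ^ μ := by
    rw [mk_prod, lift_id, lift_id]
    exact mul_le_of_le h0 (finset_card_le h0 hX) (finset_card_le h0 (finset_card_le h0 hX))
  refine (power_le_power_right hC).trans ?_
  rw [← power_mul]
  refine power_le_power_left two_ne_zero ?_
  exact mul_le_of_le hμ le_rfl (formulas_card_le hμ (le_max_right _ _))

theorem exists_order (κ : Cardinal.{w}) (h0 : ℵ₀ ≤ κ) :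
    ∃ (J : Type w) (_ : LinearOrder J) (I : Set J), #I ≤ κ ∧ κ < #J ∧
      ∀ c c' : J, c < c' → ∃ i ∈ I, c ≤ i ∧ i < c' := by
  classical
  have hne : {μ : Cardinal.{w} | κ < 2 ^ μ}.Nonempty := ⟨κ, cantor κ⟩
  let μ := sInf {μ : Cardinal.{w} | κ < 2 ^ μ}
  have hμ : κ < 2 ^ μ := csInf_mem hne
  have hμκ : μ ≤ κ := csInf_le' (cantor κ)
  have hmin : ∀ ν < μ, (2 : Cardinal.{w}) ^ ν ≤ κ := fun ν hν => by
    by_contra hh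
    push Not at hh
    exact absurd (csInf_le' (s := {μ : Cardinal.{w} | κ < 2 ^ μ}) hh) (not_le.2 hν)
  let K := μ.ord.ToType
  let mid : (Σ α : K, (Set.Iio α → Bool)) → Lex (K → Bool) := fun x =>
    toLex fun β => if h : β < x.1 then x.2 ⟨β, h⟩ else if β = x.1 then false else true
  refine ⟨Lex (K → Bool), inferInstance, Set.range mid, ?_, ?_, ?_⟩
  · refine mk_range_le.trans ?_
    rw [mk_sigma]
    refine (sum_le_mk_mul_iSup _).trans ?_
    refine mul_le_of_le h0 (by simpa [K] using hμκ) (ciSup_le' fun α => ?_)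
    have := hmin _ (mk_Iio_toType_ord_lt α)
    simpa using this
  · show κ < #(K → Bool)
    simpa [K] using hμ
  · rintro c c' ⟨α, hα, hlt⟩
    have hlt' := Bool.lt_iff.1 hlt
    refine ⟨_, ⟨⟨α, fun β => c β⟩, rfl⟩, ?_, ?_⟩
    · by_cases he : c = mid ⟨α, fun β => c β⟩
      · exact he.le
      · apply le_of_not_gt
        rintro ⟨β, hβ, hl⟩
        have hl' := Bool.lt_iff.1 hl
        have h1 := hl'.1
        have h2 := hl'.2
        have h1 : (if h : β < α then c β else if β = α then false else true) = false := h1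
        rcases lt_trichotomy β α with h | h | h
        · simp only [h, dite_true] at h1; rw [h1] at h2; cases h2
        · subst h; rw [hlt'.1] at h2; cases h2
        · simp [not_lt.2 h.le, h.ne'] at h1
    · refine ⟨α, fun β hβ => ?_, ?_⟩
      · have hβ' : β < α := hβ
        rw [← hα β hβ]
        simp [mid, hβ']
      · exact Bool.lt_iff.2 ⟨by simp [mid], hlt'.2⟩

theorem exists_small {M : Type max u v} [L.Structure M] (s : Set M) (κ : Cardinal.{max u v})
    (h0 : ℵ₀ ≤ κ) (hL : L.card ≤ κ) (hs : #s ≤ κ) :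
    ∃ S : L.ElementarySubstructure M, s ⊆ S ∧ #S ≤ κ := by
  rcases le_total κ #M with h | h
  · obtain ⟨S, h1, h2⟩ := exists_elementarySubstructure_card_eq L s κ h0 (by simpa using hs)
      (by simpa using hL) (by simpa using h)
    exact ⟨S, h1, by simpa using h2.le⟩
  · exact ⟨⊤, fun _ _ => trivial, (mk_set_le _).trans h⟩

/-- All but the last coordinate of a tuple. -/
def front {m : ℕ} {M : Type*} (x : Fin (m + 1) → M) : Fin m → M := fun j => x j.castSucc

theorem count (T : L.Theory) (κ : Cardinal.{max u v}) (h0 : ℵ₀ ≤ κ) (hL : L.card ≤ κ)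
    (hκ : IsKappaStable T κ) (M : Type max u v) [L.Structure M] [Nonempty M] (hM : M ⊨ T)
    (A : Set M) (hA : #A ≤ κ) (m : ℕ) :
    ∃ (C : Type max u v) (g : (Fin m → M) → C), #C ≤ κ ∧ ∀ x y, g x = g y →
      ∀ ψ : L.Formula (A ⊕ Fin m), ψ.Realize (Sum.elim (↑) x) → ψ.Realize (Sum.elim (↑) y) := by
  classical
  induction m with
  | zero =>
    refine ⟨PUnit, fun _ => ⟨⟩, by simpa using (one_lt_aleph0.le.trans h0), fun x y _ ψ h => ?_⟩
    rwa [Subsingleton.elim y x]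
  | succ m ih =>
    obtain ⟨C, g, hC, hg⟩ := ih
    let rep := Function.invFun g
    have hrep : ∀ x, g (rep (g x)) = g x := fun x => Function.invFun_eq ⟨x, rfl⟩
    obtain ⟨N, hN, hNκ⟩ := exists_small (L := L) (A ∪ ⋃ k, Set.range (rep k)) κ h0 hL (by
      refine (mk_union_le _ _).trans (add_le_of_le h0 hA ?_)
      refine (mk_iUnion_le _).trans (mul_le_of_le h0 hC (ciSup_le' fun k => ?_))
      have : (Set.range (rep k)).Countable := Set.countable_range _
      exact (le_aleph0_iff_set_countable.2 this).trans h0)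
    have hNT : N ⊨ T := (N.theory_model_iff T).2 hM
    have hNt := hκ N hNT hNκ
    let incl : A → N := fun a => ⟨a, hN (Or.inl a.2)⟩
    let r : C → Fin m → N := fun k j => ⟨rep k j, hN (Or.inr (Set.mem_iUnion.2 ⟨k, j, rfl⟩))⟩
    let ρ : A ⊕ Fin (m+1) → (A ⊕ Fin m) ⊕ Fin 1 :=
      Sum.elim (fun a => .inl (.inl a)) (fun i => Fin.lastCases (.inr 0) (fun j => .inl (.inr j)) i)
    let tr : C → L.Formula (A ⊕ Fin (m+1)) → L.Formula (N ⊕ Fin 1) := fun k ψ =>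
      (ψ.relabel ρ).relabel (Sum.map (Sum.elim incl (r k)) id)
    have key : ∀ x : Fin (m+1) → M, ∃ p : (L.elementaryDiagram N).CompleteType (Fin 1),
        ∀ ψ ∈ tr (g (front x)) '' {ψ | ψ.Realize (Sum.elim (↑) x)}, sent ψ ∈ p := by
      intro x
      refine type_exists N _ fun s hs => ?_
      obtain ⟨s', hs', rfl⟩ := Finset.subset_set_image_iff.1 hs
      let Ψ : L.Formula (A ⊕ Fin (m+1)) := Formula.iInf (fun ψ : s' => ψ.1)
      have h1 : ((Ψ.relabel ρ).iExs (Fin 1)).Realize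
          (Sum.elim (↑) (front x) : A ⊕ Fin m → M) := by
        refine Formula.realize_iExs.2 ⟨fun _ => x (Fin.last m), ?_⟩
        rw [Formula.realize_relabel]
        have : (Sum.elim (Sum.elim (↑) (front x)) (fun _ => x (Fin.last m)) ∘ ρ)
            = (Sum.elim (↑) x : A ⊕ Fin (m+1) → M) := by
          ext (a | i)
          · simp [ρ]
          · refine Fin.lastCases ?_ (fun j => ?_) i <;> simp [ρ, front]
        rw [this, Formula.realize_iInf]
        exact fun ψ => hs' ψ.2
      have h2 := hg _ _ (hrep (front x)).symm _ h1
      have h3 : (Sum.elim (↑) (rep (g (front x))) : A ⊕ Fin m → M)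
          = N.subtype ∘ (Sum.elim incl (r (g (front x)))) := by
        ext (a | i) <;> simp [incl, r]
      rw [h3, N.subtype.map_formula] at h2
      obtain ⟨e, he⟩ := Formula.realize_iExs.1 h2
      refine ⟨e, fun ψ' hψ' => ?_⟩
      obtain ⟨ψ, hψ, rfl⟩ := Finset.mem_image.1 hψ'
      rw [Formula.realize_relabel, Formula.realize_iInf] at he
      have := he ⟨ψ, hψ⟩
      simp only [tr]
      rw [Formula.realize_relabel, Formula.realize_relabel, Sum.elim_comp_map]
      exact this
    choose P hP using key
    refine ⟨C × (L.elementaryDiagram N).CompleteType (Fin 1), fun x => (g (front x), P x), ?_, ?_⟩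
    · rw [mk_prod, lift_id, lift_id]
      exact mul_le_of_le h0 hC hNt
    · intro x y hxy ψ hψ
      obtain ⟨h1, h2⟩ := Prod.ext_iff.1 hxy
      simp only at h1 h2
      by_contra hn
      have hx := hP x _ ⟨ψ, hψ, rfl⟩
      have hy := hP y _ ⟨ψ.not, Formula.realize_not.2 hn, rfl⟩
      rw [← h2, ← h1] at hy
      obtain ⟨K, _, f, c, hp⟩ := type_realized N (P x)
      rw [hp] at hx hy
      simp only [tr] at hx hy
      rw [Formula.realize_relabel, Formula.realize_relabel] at hx hy
      exact Formula.realize_not.1 hy hx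

theorem backward (T : L.Theory) (κ : Cardinal.{max u v}) (h0 : ℵ₀ ≤ κ) (hL : L.card ≤ κ)
    (hκ : IsKappaStable T κ) : IsStableTheory T := by
  classical
  rintro m n φ M0 ⟨a, b, hab⟩
  obtain ⟨J, _, I, hI, hJ, hd⟩ := exists_order κ h0
  let U : Ultrafilter (Finset J) := Ultrafilter.of atTop
  let M := (U : Filter (Finset J)).Product (fun _ => M0)
  let rk : J → Finset J → ℕ := fun c S => (S.filter (· < c)).card
  have hrk : ∀ c d : J, ∀ S : Finset J, c ∈ S → d ∈ S → (rk c S ≤ rk d S ↔ c ≤ d) := by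
    intro c d S hc hdS
    constructor
    · intro h
      by_contra hcd
      push Not at hcd
      refine absurd h (not_le.2 (Finset.card_lt_card ?_))
      refine Finset.ssubset_iff_subset_ne.2 ⟨fun x hx => ?_, fun he => ?_⟩
      · rw [Finset.mem_filter] at hx ⊢
        exact ⟨hx.1, hx.2.trans hcd⟩
      · have : d ∈ S.filter (· < c) := Finset.mem_filter.2 ⟨hdS, hcd⟩
        rw [← he, Finset.mem_filter] at this
        exact lt_irrefl _ this.2
    · intro h
      refine Finset.card_le_card fun x hx => ?_
      rw [Finset.mem_filter] at hx ⊢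
      exact ⟨hx.1, hx.2.trans_le h⟩
  let aa : J → Fin m → (Finset J → M0) := fun c i S => a (rk c S) i
  let bb : J → Fin n → (Finset J → M0) := fun c i S => b (rk c S) i
  let a' : J → Fin m → M := fun c i => Quotient.mk ((U : Filter (Finset J)).productSetoid (fun _ => M0)) (aa c i)
  let b' : J → Fin n → M := fun c i => Quotient.mk ((U : Filter (Finset J)).productSetoid (fun _ => M0)) (bb c i)
  have hM : M ⊨ T := by
    refine Theory.model_iff _ |>.2 fun σ hσ => ?_
    refine (Ultraproduct.sentence_realize σ).2 (Eventually.of_forall fun _ => ?_)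
    exact Theory.realize_sentence_of_mem T hσ
  have : Nonempty M := Ultraproduct.Product.instNonempty
  have hord : ∀ c d : J, φ.Realize (Sum.elim (a' c) (b' d)) ↔ c ≤ d := by
    intro c d
    have h1 : (Sum.elim (a' c) (b' d)) = fun i =>
        (Quotient.mk ((U : Filter (Finset J)).productSetoid (fun _ => M0)) ((Sum.elim (aa c) (bb d)) i) : M) := by
      ext (i | i) <;> rfl
    rw [h1]
    refine (Ultraproduct.realize_formula_cast (u := U) φ (Sum.elim (aa c) (bb d))).trans ?_
    have h2 : ∀ S, (fun i => (Sum.elim (aa c) (bb d)) i S) = Sum.elim (a (rk c S)) (b (rk d S)) := by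
      intro S; ext (i | i) <;> rfl
    simp only [h2, hab]
    have h3 : ∀ᶠ S in (U : Filter (Finset J)), (rk c S ≤ rk d S ↔ c ≤ d) := by
      refine Ultrafilter.of_le atTop ((eventually_ge_atTop ({c, d} : Finset J)).mono fun S hS => ?_)
      exact hrk c d S (hS (by simp)) (hS (by simp))
    rw [eventually_congr h3, eventually_const]
  let A : Set M := ⋃ i : I, Set.range (b' i)
  have hA : #A ≤ κ := by
    refine (mk_iUnion_le _).trans (mul_le_of_le h0 hI (ciSup_le' fun k => ?_))
    have : (Set.range (b' k)).Countable := Set.countable_range _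
    exact (le_aleph0_iff_set_countable.2 this).trans h0
  obtain ⟨C, g, hC, hg⟩ := count T κ h0 hL hκ M hM A hA m
  refine absurd hC (not_le.2 (hJ.trans_le (mk_le_of_injective (f := fun c => g (a' c)) ?_)))
  have main : ∀ c c' : J, c < c' → g (a' c) ≠ g (a' c') := by
    intro c c' hcc he
    obtain ⟨i, hi, h1, h2⟩ := hd c c' hcc
    let β : Fin n → A := fun k => ⟨b' i k, Set.mem_iUnion.2 ⟨⟨i, hi⟩, k, rfl⟩⟩
    have rel : ∀ x : Fin m → M, (φ.relabel (Sum.elim Sum.inr (Sum.inl ∘ β)) :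
        L.Formula (A ⊕ Fin m)).Realize (Sum.elim (↑) x) ↔ φ.Realize (Sum.elim x (b' i)) := by
      intro x
      rw [Formula.realize_relabel]
      apply iff_of_eq; congr 1
      ext (k | k) <;> simp [β]
    have := hg _ _ he (φ.relabel (Sum.elim Sum.inr (Sum.inl ∘ β)))
    rw [rel, rel, hord, hord] at this
    exact absurd (this h1) (not_le.2 h2)
  intro c c' he
  rcases lt_trichotomy c c' with h | h | h
  · exact absurd he (main _ _ h)
  · exact h
  · exact absurd he.symm (main _ _ h)

end StabProof

/-- A satisfiable theory `T` is stable if and only if it is `κ`-stable for some infinite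
cardinal `κ` with `L.card ≤ κ`. -/
theorem isStableTheory_iff_exists_kappaStable (T : L.Theory) (hT : T.IsSatisfiable) :
    IsStableTheory T ↔
      ∃ κ : Cardinal.{max u v}, ℵ₀ ≤ κ ∧ L.card ≤ κ ∧ IsKappaStable T κ := by
  constructor
  · exact StabProof.forward T
  · rintro ⟨κ, h0, hL, hκ⟩
    exact StabProof.backward T κ h0 hL hκ
end

section
/- Let T be a satisfiable first-order theory in a language L. Then T is stable if and only if every type over every model of T is definable: for every model M of T, every complete type p over M in n variables, and every L-formula φ with free variables indexed by Fin n ⊕ Fin r, there exists an L[[M]]-formula ψ with free variables indexed by Fin r such that for every tuple b : Fin r → M, the L[[M]]-formula in variables Fin n obtained from φ by substituting the constants for b into the second variable block belongs to p if and only if ψ holds of b in M. -/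
open FirstOrder FirstOrder.Language

universe u v

variable {L : FirstOrder.Language.{u, v}}

/-- The `L[[M]]`-formula in variables `Fin n` obtained from an `L`-formula
`φ(x₁, …, xₙ; y₁, …, y_r)` by substituting the constants for the tuple `b : Fin r → M`
into the second variable block. -/
noncomputable def substConstants {M : Type max u v} [L.Structure M] {n r : ℕ}
    (φ : L.Formula (Fin n ⊕ Fin r)) (b : Fin r → M) : L[[M]].Formula (Fin n) :=
  ((L.lhomWithConstants M).onFormula φ).subst
    (Sum.elim (fun i => Term.var i) (fun j => (L.con (b j)).term))

/-- In `M` itself, the substituted formula means what it should. -/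
theorem realize_substConstants {M : Type max u v} [L.Structure M] {n r : ℕ}
    (φ : L.Formula (Fin n ⊕ Fin r)) (b : Fin r → M) (x : Fin n → M) :
    (substConstants φ b).Realize x ↔ φ.Realize (Sum.elim x b) := by
  unfold substConstants
  refine Iff.trans BoundedFormula.realize_subst ?_
  refine Iff.trans (LHom.realize_onFormula _ φ) ?_
  have : (fun a => ((Sum.elim (fun i => Term.var i) (fun j => (L.con (b j)).term) :
      Fin n ⊕ Fin r → L[[M]].Term (Fin n)) a).realize x) = Sum.elim x b := by
    funext a
    cases a with
    | inl a => rfl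
    | inr a => rfl
  rw [this]

/-- A version of Ramsey's theorem for pairs of natural numbers. -/
theorem ramsey_pairs (Q : ℕ → ℕ → Prop) :
    ∃ g : ℕ → ℕ, StrictMono g ∧
      ((∀ m n, m < n → Q (g m) (g n)) ∨ (∀ m n, m < n → ¬ Q (g m) (g n))) := by
  classical
  let U : Ultrafilter ℕ := Filter.hyperfilter ℕ
  have hU : (U : Filter ℕ) ≤ Filter.atTop := by
    rw [← Nat.cofinite_eq_atTop]; exact Filter.hyperfilter_le_cofinite
  have key : ∀ Q : ℕ → ℕ → Prop, (∀ᶠ i in (U : Filter ℕ), ∀ᶠ n in (U : Filter ℕ), Q i n) →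
      ∃ g : ℕ → ℕ, StrictMono g ∧ ∀ m n, m < n → Q (g m) (g n) := by
    intro Q hQ
    obtain ⟨g, -, hg⟩ := exists_seq_of_forall_finset_exists
      (fun i => ∀ᶠ n in (U : Filter ℕ), Q i n) (fun i n => i < n ∧ Q i n) (by
        intro s hs
        have h1 : ∀ᶠ y in (U : Filter ℕ), ∀ x ∈ s, x < y ∧ Q x y := by
          rw [Filter.eventually_all_finset]
          intro x hx
          exact (Filter.Eventually.filter_mono hU (Filter.eventually_gt_atTop x)).and (hs x hx)
        exact (hQ.and h1).exists)
    exact ⟨g, fun m n h => (hg m n h).1, fun m n h => (hg m n h).2⟩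
  by_cases h : ∀ᶠ i in (U : Filter ℕ), ∀ᶠ n in (U : Filter ℕ), Q i n
  · obtain ⟨g, h1, h2⟩ := key Q h
    exact ⟨g, h1, Or.inl h2⟩
  · have h' : ∀ᶠ i in (U : Filter ℕ), ∀ᶠ n in (U : Filter ℕ), ¬ Q i n := by
      rw [← Ultrafilter.eventually_not] at h
      filter_upwards [h] with i hi
      exact Ultrafilter.eventually_not.2 hi
    obtain ⟨g, h1, h2⟩ := key (fun i n => ¬ Q i n) h'
    exact ⟨g, h1, Or.inr h2⟩

/-- The Erdős–Makkai argument: a predicate on `Y` that is finitely approximated by the sections of a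
relation with no infinite order pattern depends on finitely many sections only. -/
theorem erdos_makkai {X Y : Type*} (R : X → Y → Prop) (f : Y → Prop)
    (hf : ∀ B : Finset Y, ∃ a, ∀ b ∈ B, R a b ↔ f b)
    (h1 : ¬ ∃ (a : ℕ → X) (b : ℕ → Y), ∀ i j, R (a i) (b j) ↔ i ≤ j)
    (h2 : ¬ ∃ (a : ℕ → X) (b : ℕ → Y), ∀ i j, ¬ R (a i) (b j) ↔ i ≤ j) :
    ∃ A : Finset X, ∀ b b', (∀ a ∈ A, R a b ↔ R a b') → (f b ↔ f b') := by
  classical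
  by_contra hcon
  push Not at hcon
  have hcon' : ∀ A : Finset X, ∃ b b', (∀ a ∈ A, R a b ↔ R a b') ∧ f b ∧ ¬ f b' := by
    intro A
    obtain ⟨b, b', h, h'⟩ := hcon A
    rcases h' with h' | h'
    · exact ⟨b, b', h, h'⟩
    · exact ⟨b', b, fun a ha => (h a ha).symm, h'.2, h'.1⟩
  obtain ⟨t, ht, htr⟩ := exists_seq_of_forall_finset_exists
    (fun t : X × Y × Y => f t.2.1 ∧ ¬ f t.2.2 ∧ R t.1 t.2.1 ∧ ¬ R t.1 t.2.2)
    (fun t t' => (R t.1 t'.2.1 ↔ R t.1 t'.2.2) ∧ R t'.1 t.2.1 ∧ ¬ R t'.1 t.2.2) (by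
      intro s hs
      obtain ⟨b, b', hA, hb, hb'⟩ := hcon' (s.image (fun t => t.1))
      obtain ⟨a, ha⟩ := hf ({b, b'} ∪ (s.image (fun t => t.2.1) ∪ s.image (fun t => t.2.2)))
      refine ⟨(a, b, b'), ⟨hb, hb', ?_, ?_⟩, ?_⟩
      · exact (ha b (by simp)).2 hb
      · exact fun h => hb' ((ha b' (by simp)).1 h)
      · intro x hx
        refine ⟨hA x.1 (Finset.mem_image_of_mem _ hx), ?_, ?_⟩
        · refine (ha x.2.1 ?_).2 (hs x hx).1
          exact Finset.mem_union_right _ (Finset.mem_union_left _ (Finset.mem_image_of_mem (fun t : X × Y × Y => t.2.1) hx))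
        · refine fun h => (hs x hx).2.1 ((ha x.2.2 ?_).1 h)
          exact Finset.mem_union_right _ (Finset.mem_union_right _ (Finset.mem_image_of_mem (fun t : X × Y × Y => t.2.2) hx)))
  obtain ⟨g, hg, hh⟩ := ramsey_pairs (fun i n => R (t i).1 (t n).2.1)
  rcases hh with hh | hh
  · refine h1 ⟨fun i => (t (g i)).1, fun j => (t (g (j+1))).2.2, fun i j => ?_⟩
    constructor
    · intro h
      by_contra hij
      rcases (Nat.succ_le_of_lt (not_le.1 hij)).lt_or_eq with h3 | h3
      · exact (htr _ _ (hg h3)).2.2 h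
      · subst h3
        exact (ht _).2.2.2 h
    · intro h
      have h3 : i < j + 1 := by omega
      exact (htr _ _ (hg h3)).1.1 (hh _ _ h3)
  · refine h2 ⟨fun i => (t (g i)).1, fun j => (t (g (j+1))).2.1, fun i j => ?_⟩
    constructor
    · intro h
      by_contra hij
      rcases (Nat.succ_le_of_lt (not_le.1 hij)).lt_or_eq with h3 | h3
      · exact h (htr _ _ (hg h3)).2.1
      · subst h3
        exact h (ht _).2.2.1
    · intro h
      exact hh _ _ (by omega)

/-- Complete types over `M` are finitely satisfiable in `M`. -/
theorem finitely_satisfiable {M : Type max u v} [L.Structure M] [Nonempty M] {n r : ℕ}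
    (p : (L.elementaryDiagram M).CompleteType (Fin n)) (φ : L.Formula (Fin n ⊕ Fin r))
    (B : Finset (Fin r → M)) :
    ∃ a : Fin n → M, ∀ b ∈ B,
      φ.Realize (Sum.elim a b) ↔ Formula.equivSentence (substConstants φ b) ∈ p := by
  classical
  obtain ⟨N, w, hw⟩ := Theory.exists_modelType_is_realized_in _ p
  have hmem : ∀ b, Formula.equivSentence (substConstants φ b) ∈ p ↔
      (substConstants φ b).Realize w := by
    intro b
    rw [← hw]
    exact Theory.CompleteType.formula_mem_typeOf
  let θ : L[[M]].Formula (Fin n) := Formula.iInf (fun b : B =>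
    if (substConstants φ b.1).Realize w then substConstants φ b.1 else (substConstants φ b.1).not)
  have hθ : θ.Realize w := by
    rw [Formula.realize_iInf]
    intro b
    split_ifs with h
    · exact h
    · exact h
  let σ : L[[M]].Sentence := (θ.relabel (Sum.inr : Fin n → Empty ⊕ Fin n)).iExs (Fin n)
  have hσ : N ⊨ σ := by
    refine Formula.realize_iExs.2 ⟨w, ?_⟩
    rw [Formula.realize_relabel]
    exact hθ
  have hN : N ⊨ L[[M]].completeTheory M := N.is_model
  have hσM : M ⊨ σ := (realize_iff_of_model_completeTheory M N σ).1 hσ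
  obtain ⟨a, ha⟩ := Formula.realize_iExs.1 hσM
  rw [Formula.realize_relabel] at ha
  have ha' : θ.Realize a := ha
  rw [Formula.realize_iInf] at ha'
  refine ⟨a, fun b hb => ?_⟩
  have := ha' ⟨b, hb⟩
  rw [hmem, ← realize_substConstants]
  split_ifs at this with h
  · exact ⟨fun _ => h, fun _ => this⟩
  · exact ⟨fun h' => absurd h' this, fun h' => absurd h' h⟩

/-- A set depending on finitely many sections `φ(a, ·)` is definable with parameters. -/
theorem exists_formula_of_finset {M : Type max u v} [L.Structure M] {n r : ℕ}
    (φ : L.Formula (Fin n ⊕ Fin r)) (f : (Fin r → M) → Prop) (A : Finset (Fin n → M))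
    (hA : ∀ b b' : Fin r → M,
      (∀ a ∈ A, φ.Realize (Sum.elim a b) ↔ φ.Realize (Sum.elim a b')) → (f b ↔ f b')) :
    ∃ ψ : L[[M]].Formula (Fin r), ∀ b : Fin r → M, f b ↔ ψ.Realize b := by
  classical
  let sec : (Fin n → M) → L[[M]].Formula (Fin r) := fun a =>
    substConstants (φ.relabel Sum.swap) a
  have hsec : ∀ a b, (sec a).Realize b ↔ φ.Realize (Sum.elim a b) := by
    intro a b
    refine (realize_substConstants _ _ _).trans ?_
    rw [Formula.realize_relabel]
    have : Sum.elim b a ∘ Sum.swap = Sum.elim a b := by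
      funext x; cases x <;> rfl
    rw [this]
  let pat : (Fin r → M) → Set A := fun b => {a | φ.Realize (Sum.elim a.1 b)}
  let G : Type := {S : Set (Fin A.card) // ∃ b, f b ∧ pat b = {a | A.equivFin a ∈ S}}
  refine ⟨Formula.iSup (fun S : G => Formula.iInf (fun a : A =>
    if A.equivFin a ∈ S.1 then sec a.1 else (sec a.1).not)), fun b => ?_⟩
  rw [Formula.realize_iSup]
  constructor
  · intro hb
    refine ⟨⟨{i | (A.equivFin.symm i) ∈ pat b}, b, hb, by ext a; simp⟩, ?_⟩
    rw [Formula.realize_iInf]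
    intro a
    split_ifs with h
    · rw [hsec]
      simpa [pat] using h
    · rw [Formula.realize_not, hsec]
      simpa [pat] using h
  · rintro ⟨⟨S, b', hb', hS⟩, h⟩
    rw [Formula.realize_iInf] at h
    refine (hA b b' fun a ha => ?_).2 hb'
    have h1 := h ⟨a, ha⟩
    have h2 : φ.Realize (Sum.elim a b') ↔ A.equivFin ⟨a, ha⟩ ∈ S := by
      have := Set.ext_iff.1 hS ⟨a, ha⟩
      simpa [pat] using this
    rw [h2]
    split_ifs at h1 with h3
    · exact ⟨fun _ => h3, fun _ => (hsec _ _).1 h1⟩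
    · exact ⟨fun h4 => absurd ((hsec _ _).2 h4) h1, fun h4 => absurd h4 h3⟩

/-- Stability implies definability of types. -/
theorem definable_of_stable (T : L.Theory) (hs : IsStableTheory T)
    (M : Type max u v) [L.Structure M] [Nonempty M] (hM : M ⊨ T) (n : ℕ)
    (p : (L.elementaryDiagram M).CompleteType (Fin n)) (r : ℕ) (φ : L.Formula (Fin n ⊕ Fin r)) :
    ∃ ψ : L[[M]].Formula (Fin r), ∀ b : Fin r → M,
      Formula.equivSentence (substConstants φ b) ∈ p ↔ ψ.Realize b := by
  obtain ⟨A, hA⟩ := erdos_makkai (fun (a : Fin n → M) (b : Fin r → M) => φ.Realize (Sum.elim a b))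
    (fun b => Formula.equivSentence (substConstants φ b) ∈ p)
    (finitely_satisfiable p φ)
    (hs n r φ (Theory.ModelType.of T M))
    (hs n r φ.not (Theory.ModelType.of T M))
  exact exists_formula_of_finset φ _ A hA

/-- The limit type of a family of tuples along an ultrafilter. -/
theorem exists_limit_type {L' : FirstOrder.Language} {M : Type*} [L'.Structure M] [Nonempty M]
    {J : Type*} (V : Ultrafilter J) {m : ℕ} (a : J → Fin m → M) :
    ∃ p : (L'.completeTheory M).CompleteType (Fin m), ∀ χ : L'.Formula (Fin m),
      Formula.equivSentence χ ∈ p ↔ ∀ᶠ i in (V : Filter J), χ.Realize (a i) := by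
  have hN : (V : Filter J).Product (fun _ : J => M) ⊨ L'.completeTheory M := by
    refine ⟨fun χ hχ => ?_⟩
    refine (Ultraproduct.sentence_realize (u := V) (M := fun _ : J => M) χ).2 ?_
    exact Filter.Eventually.of_forall fun _ => hχ
  let c : Fin m → (V : Filter J).Product (fun _ : J => M) :=
    fun s => (Quotient.mk _ (fun i : J => a i s))
  refine ⟨(L'.completeTheory M).typeOf c, fun χ => ?_⟩
  refine Theory.CompleteType.formula_mem_typeOf.trans ?_
  exact Ultraproduct.realize_formula_cast (u := V) (M := fun _ : J => M) χ
    (fun s (i : J) => a i s)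

/-- If types over models are definable, then no formula has the order property. -/
theorem stable_of_definable (T : L.Theory)
    (hd : ∀ (M : Type max u v) [L.Structure M] [Nonempty M], M ⊨ T →
        ∀ (n : ℕ) (p : (L.elementaryDiagram M).CompleteType (Fin n))
          (r : ℕ) (φ : L.Formula (Fin n ⊕ Fin r)),
          ∃ ψ : L[[M]].Formula (Fin r),
            ∀ b : Fin r → M,
              Formula.equivSentence (substConstants φ b) ∈ p ↔ ψ.Realize b) :
    IsStableTheory T := by
  classical
  rintro m n φ M₀ ⟨a, b, hab⟩
  let U : Ultrafilter ℕ := Filter.hyperfilter ℕ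
  have hU : (U : Filter ℕ) ≤ Filter.atTop := by
    rw [← Nat.cofinite_eq_atTop]; exact Filter.hyperfilter_le_cofinite
  let M : Type max u v := (U : Filter ℕ).Product (fun _ : ℕ => (M₀ : Type max u v))
  let mk : (ℕ → M₀) → M := fun x => (Quotient.mk _ x)
  -- Łoś for `M`
  have los : ∀ {β : Type (max u v)} (χ : L.Formula β) (x : β → ℕ → M₀),
      χ.Realize (fun i => mk (x i)) ↔ ∀ᶠ k in (U : Filter ℕ), χ.Realize (fun i => x i k) :=
    fun χ x => Ultraproduct.realize_formula_cast χ x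
  have los0 : ∀ {β : Type} (χ : L.Formula β) (x : β → ℕ → M₀),
      χ.Realize (fun i => mk (x i)) ↔ ∀ᶠ k in (U : Filter ℕ), χ.Realize (fun i => x i k) :=
    fun χ x => Ultraproduct.realize_formula_cast χ x
  have hMT : M ⊨ T := by
    refine ⟨fun χ hχ => ?_⟩
    refine (Ultraproduct.sentence_realize (u := U) (M := fun _ : ℕ => (M₀ : Type max u v)) χ).2 ?_
    exact Filter.Eventually.of_forall fun _ => M₀.is_model.realize_of_mem _ hχ
  let a' : (ℕ → ℕ) → Fin m → M := fun i s => mk (fun k => a (i k) s)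
  let b' : (ℕ → ℕ) → Fin n → M := fun j s => mk (fun k => b (j k) s)
  have hab' : ∀ i j : ℕ → ℕ, φ.Realize (Sum.elim (a' i) (b' j)) ↔
      ∀ᶠ k in (U : Filter ℕ), i k ≤ j k := by
    intro i j
    have h1 : Sum.elim (a' i) (b' j) = fun s => mk
        ((Sum.elim (fun s k => a (i k) s) (fun s k => b (j k) s) : _ → ℕ → M₀) s) := by
      funext s; cases s <;> rfl
    rw [h1, los0]
    refine Filter.eventually_congr (Filter.Eventually.of_forall fun k => ?_)
    rw [← hab]
    have h2 : (fun s => (Sum.elim (fun s k => a (i k) s) (fun s k => b (j k) s) :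
        _ → ℕ → M₀) s k) = Sum.elim (a (i k)) (b (j k)) := by
      funext s; cases s <;> rfl
    rw [h2]
  -- the nonstandard numbers
  let J : Type := {f : ℕ → ℕ // Filter.Tendsto f (U : Filter ℕ) Filter.atTop}
  have : Nonempty J := ⟨⟨id, hU⟩⟩
  have : IsCodirectedOrder J := ⟨fun f g => ⟨⟨fun k => min (f.1 k) (g.1 k), by
    rw [Filter.tendsto_atTop]
    intro N
    filter_upwards [Filter.tendsto_atTop.1 f.2 N, Filter.tendsto_atTop.1 g.2 N] with k h1 h2
    exact le_min h1 h2⟩, fun k => min_le_left _ _, fun k => min_le_right _ _⟩⟩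
  let V : Ultrafilter J := Ultrafilter.of Filter.atBot
  have hV : (V : Filter J) ≤ Filter.atBot := Ultrafilter.of_le _
  obtain ⟨p, hpV⟩ := exists_limit_type (L' := L[[M]]) V (fun i : J => a' i.1)
  have hp : ∀ j : ℕ → ℕ, Formula.equivSentence (substConstants φ (b' j)) ∈ p ↔
      Filter.Tendsto j (U : Filter ℕ) Filter.atTop := by
    intro j
    refine (hpV _).trans ?_
    have h1 : ∀ i : J, (substConstants φ (b' j)).Realize (fun s => a' i.1 s) ↔
        ∀ᶠ k in (U : Filter ℕ), i.1 k ≤ j k :=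
      fun i => (realize_substConstants _ _ _).trans (hab' i.1 j)
    simp only [h1]
    constructor
    · intro h
      obtain ⟨i, hi⟩ := h.exists
      exact Filter.tendsto_atTop_mono' _ hi i.2
    · intro h
      refine (Filter.Eventually.filter_mono hV (Filter.eventually_le_atBot (⟨j, h⟩ : J))).mono fun i hi => ?_
      exact Filter.Eventually.of_forall fun k => hi k
  obtain ⟨ψ, hψ⟩ := hd M hMT m p n φ
  let χ : L.Formula (M ⊕ Fin n) := BoundedFormula.constantsVarsEquiv ψ
  let out : M → ℕ → M₀ := fun d => Quotient.out d
  have hout : ∀ d, mk (out d) = d := fun d => Quotient.out_eq d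
  let S : ℕ → ℕ → Prop := fun k l => χ.Realize (Sum.elim (fun d => out d k) (b l))
  have hS : ∀ j : ℕ → ℕ, Filter.Tendsto j (U : Filter ℕ) Filter.atTop ↔
      ∀ᶠ k in (U : Filter ℕ), S k (j k) := by
    intro j
    rw [← hp, hψ]
    have h0 : ψ.Realize (b' j) ↔ χ.Realize (Sum.elim (fun d : M => d) (b' j)) :=
      (BoundedFormula.realize_constantsVarsEquiv (φ := ψ) (v := b' j)).symm
    rw [h0]
    have h1 : Sum.elim (fun d : M => d) (b' j) = fun s => mk
        ((Sum.elim out (fun s k => b (j k) s) : _ → ℕ → M₀) s) := by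
      funext s
      cases s with
      | inl d => exact (hout d).symm
      | inr s => rfl
    rw [h1, los]
    refine Filter.eventually_congr (Filter.Eventually.of_forall fun k => ?_)
    have h2 : (fun s => (Sum.elim out (fun s k => b (j k) s) :
        _ → ℕ → M₀) s k) = Sum.elim (fun d => out d k) (b (j k)) := by
      funext s; cases s <;> rfl
    rw [h2]
  -- the least element of the internal set
  let μ : ℕ → ℕ := fun k => sInf {l | S k l}
  have hμ : ∀ᶠ k in (U : Filter ℕ), S k (μ k) := by
    refine ((hS id).1 hU).mono fun k hk => ?_
    exact Nat.sInf_mem (s := {l | S k l}) ⟨k, hk⟩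
  have hμt := (hS μ).2 hμ
  have hμ1 : Filter.Tendsto (fun k => μ k - 1) (U : Filter ℕ) Filter.atTop := by
    rw [Filter.tendsto_atTop] at hμt ⊢
    intro N
    exact (hμt (N + 1)).mono fun k hk => by omega
  have h3 := (hS _).1 hμ1
  obtain ⟨k, hk1, hk2⟩ := (h3.and (Filter.tendsto_atTop.1 hμt 1)).exists
  have : μ k ≤ μ k - 1 := Nat.sInf_le (s := {l | S k l}) hk1
  omega

/-- A satisfiable theory `T` is stable if and only if all types over models of `T` are
definable: for every model `M` of `T`, every complete type `p` over `M` in `n` variables,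
and every `L`-formula `φ` in variables `Fin n ⊕ Fin r`, there is an `L[[M]]`-formula `ψ`
in variables `Fin r` such that for every `b : Fin r → M`, the formula `φ(x̄, b)` belongs
to `p` iff `ψ` holds of `b` in `M`. -/
theorem isStableTheory_iff_types_definable (T : L.Theory) (hT : T.IsSatisfiable) :
    IsStableTheory T ↔
      ∀ (M : Type max u v) [L.Structure M] [Nonempty M], M ⊨ T →
        ∀ (n : ℕ) (p : (L.elementaryDiagram M).CompleteType (Fin n))
          (r : ℕ) (φ : L.Formula (Fin n ⊕ Fin r)),
          ∃ ψ : L[[M]].Formula (Fin r),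
            ∀ b : Fin r → M,
              Formula.equivSentence (substConstants φ b) ∈ p ↔ ψ.Realize b := by
  constructor
  · intro hs M _ _ hM n p r φ
    exact definable_of_stable T hs M hM n p r φ
  · intro hd
    exact stable_of_definable T hd
end

section
/- For every n and every set S ⊆ (Fin n → ℝ) of n-tuples of real numbers, S is definable without parameters in the first-order language of ordered rings (with ℝ carrying its natural ring and order structure) if and only if S belongs to the Boolean algebra of subsets of Fin n → ℝ generated by the sets {x | aeval x P = 0} and {x | 0 < aeval x P} for polynomials P ∈ MvPolynomial (Fin n) ℤ; that is, the subsets of ℝⁿ definable without parameters are exactly the semialgebraic sets defined over the prime field. -/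
open FirstOrder FirstOrder.Language

/-- `ℝ` as a structure for the first-order language of rings, via its ring operations. -/
noncomputable instance : FirstOrder.Language.ring.Structure ℝ :=
  (FirstOrder.Ring.compatibleRingOfRing ℝ).toStructure

/-- `ℝ` as a structure for the language of orders, via its linear order. -/
instance : FirstOrder.Language.order.Structure ℝ :=
  FirstOrder.Language.orderStructure ℝ

/-- Membership in the Boolean algebra of subsets of `α` generated by a family `G` of
subsets: the closure of `G` under complements and (finite) unions, containing `univ`. -/
inductive MemBooleanAlgebraGen {α : Type*} (G : Set (Set α)) : Set α → Prop
  | basic {s : Set α} : s ∈ G → MemBooleanAlgebraGen G s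
  | univ : MemBooleanAlgebraGen G Set.univ
  | compl {s : Set α} : MemBooleanAlgebraGen G s → MemBooleanAlgebraGen G sᶜ
  | union {s t : Set α} : MemBooleanAlgebraGen G s → MemBooleanAlgebraGen G t →
      MemBooleanAlgebraGen G (s ∪ t)

open Polynomial Filter Topology

namespace TS

/-- `Z` is a finite partial order isomorphism. -/
def PI (Z : Finset (ℝ × ℝ)) : Prop := ∀ p ∈ Z, ∀ q ∈ Z, (p.1 < q.1 ↔ p.2 < q.2)

/-- `x` and `y` have the same position relative to `Z`. -/
def SP (Z : Finset (ℝ × ℝ)) (x y : ℝ) : Prop :=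
  ∀ p ∈ Z, (p.1 < x ↔ p.2 < y) ∧ (x < p.1 ↔ y < p.2)

/-- The swapped partial isomorphism. -/
noncomputable def swp (Z : Finset (ℝ × ℝ)) : Finset (ℝ × ℝ) := Z.image Prod.swap

lemma mem_swp {Z : Finset (ℝ × ℝ)} {p : ℝ × ℝ} : p ∈ swp Z ↔ (p.2, p.1) ∈ Z := by
  simp only [swp, Finset.mem_image]
  constructor
  · rintro ⟨q, hq, rfl⟩; exact hq
  · intro h; exact ⟨_, h, rfl⟩

lemma PI.swp {Z : Finset (ℝ × ℝ)} (h : PI Z) : PI (swp Z) := by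
  intro p hp q hq
  exact (h _ (mem_swp.1 hp) _ (mem_swp.1 hq)).symm

lemma SP.swp {Z : Finset (ℝ × ℝ)} {x y : ℝ} (h : SP Z x y) : SP (swp Z) y x := by
  intro p hp
  have := h _ (mem_swp.1 hp)
  exact ⟨this.1.symm, this.2.symm⟩

lemma SP.of_swp {Z : Finset (ℝ × ℝ)} {x y : ℝ} (h : SP (TS.swp Z) y x) : SP Z x y := by
  intro p hp
  have := h (p.2, p.1) (mem_swp.2 hp)
  exact ⟨this.1.symm, this.2.symm⟩

lemma SP.trans {Z : Finset (ℝ × ℝ)} {x y x' y' : ℝ} (h : SP Z x y) (h1 : SP Z x' y)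
    (h2 : SP Z x y') : SP Z x' y' := by
  intro p hp
  have a := h p hp
  have b := h1 p hp
  have c := h2 p hp
  exact ⟨b.1.trans (a.1.symm.trans c.1), b.2.trans (a.2.symm.trans c.2)⟩

lemma SP.convex {Z : Finset (ℝ × ℝ)} {x y x' t : ℝ} (h : SP Z x y) (h1 : SP Z x' y)
    (ht : x ≤ t) (ht' : t ≤ x') : SP Z t y := by
  intro p hp
  have a := h p hp
  have b := h1 p hp
  refine ⟨⟨fun h => b.1.1 (h.trans_le ht'), fun h => (a.1.2 h).trans_le ht⟩,
    ⟨fun h => a.2.1 (ht.trans_lt h), fun h => ht'.trans_lt (b.2.2 h)⟩⟩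

lemma SP.of_mem {Z : Finset (ℝ × ℝ)} (hZ : PI Z) {p : ℝ × ℝ} (hp : p ∈ Z) : SP Z p.1 p.2 :=
  fun q hq => ⟨hZ q hq p hp, hZ p hp q hq⟩

lemma SP.eq_iff {Z : Finset (ℝ × ℝ)} {x y : ℝ} (h : SP Z x y) {p : ℝ × ℝ} (hp : p ∈ Z) :
    p.1 = x ↔ p.2 = y := by
  have := h p hp
  constructor
  · intro e
    exact le_antisymm (not_lt.1 fun h' => absurd (this.2.2 h') (by simp [e]))
      (not_lt.1 fun h' => absurd (this.1.2 h') (by simp [e]))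
  · intro e
    exact le_antisymm (not_lt.1 fun h' => absurd (this.2.1 h') (by simp [e]))
      (not_lt.1 fun h' => absurd (this.1.1 h') (by simp [e]))

lemma cmp_congr' {a b c d : ℝ} (h1 : a < b ↔ c < d) (h2 : b < a ↔ d < c) :
    cmp a b = cmp c d := by
  unfold cmp cmpUsing
  simp only [h1, h2]

lemma exists_SP {Z : Finset (ℝ × ℝ)} (hZ : PI Z) (x : ℝ) : ∃ y, SP Z x y := by
  obtain ⟨b, hb⟩ := Order.PartialIso.exists_across (β := ℝ)
    (⟨Z, fun p hp q hq => cmp_congr' (hZ p hp q hq) (hZ q hq p hp)⟩ : Order.PartialIso ℝ ℝ) x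
  refine ⟨b, fun p hp => ?_⟩
  have h := hb p hp
  exact ⟨lt_iff_lt_of_cmp_eq_cmp h, lt_iff_lt_of_cmp_eq_cmp ((cmp_eq_cmp_symm).1 h)⟩

lemma exists_SP' {Z : Finset (ℝ × ℝ)} (hZ : PI Z) (y : ℝ) : ∃ x, SP Z x y := by
  obtain ⟨x, hx⟩ := exists_SP hZ.swp y
  exact ⟨x, hx.of_swp⟩

lemma lt_of_deriv_pos (f : ℝ[X]) {u v : ℝ} (huv : u < v)
    (h : ∀ t, u < t → t < v → 0 < f.derivative.eval t) : f.eval u < f.eval v := by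
  have : StrictMonoOn (fun x => f.eval x) (Set.Icc u v) := by
    apply strictMonoOn_of_deriv_pos (convex_Icc u v) f.continuous.continuousOn
    intro t ht
    rw [interior_Icc] at ht
    rw [Polynomial.deriv]
    exact h t ht.1 ht.2
  exact this ⟨le_rfl, huv.le⟩ ⟨huv.le, le_rfl⟩ huv

/-- Hypotheses on a pair of polynomials relative to a partial isomorphism. -/
structure Pre (Z : Finset (ℝ × ℝ)) (f g : ℝ[X]) : Prop where
  pi : PI Z
  sgn : ∀ p ∈ Z, SignType.sign (f.eval p.1) = SignType.sign (g.eval p.2)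
  bot : ∃ s, (∀ᶠ t in atBot, SignType.sign (f.eval t) = s) ∧
    (∀ᶠ t in atBot, SignType.sign (g.eval t) = s)
  top : ∃ s, (∀ᶠ t in atTop, SignType.sign (f.eval t) = s) ∧
    (∀ᶠ t in atTop, SignType.sign (g.eval t) = s)

lemma Pre.swp {Z : Finset (ℝ × ℝ)} {f g : ℝ[X]} (h : Pre Z f g) : Pre (swp Z) g f where
  pi := h.pi.swp
  sgn p hp := (h.sgn _ (mem_swp.1 hp)).symm
  bot := by obtain ⟨s, h1, h2⟩ := h.bot; exact ⟨s, h2, h1⟩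
  top := by obtain ⟨s, h1, h2⟩ := h.top; exact ⟨s, h2, h1⟩

lemma Pre.neg {Z : Finset (ℝ × ℝ)} {f g : ℝ[X]} (h : Pre Z f g) : Pre Z (-f) (-g) where
  pi := h.pi
  sgn p hp := by simp [Left.sign_neg, h.sgn p hp]
  bot := by
    obtain ⟨s, h1, h2⟩ := h.bot
    exact ⟨-s, h1.mono (by simp [Left.sign_neg]), h2.mono (by simp [Left.sign_neg])⟩
  top := by
    obtain ⟨s, h1, h2⟩ := h.top
    exact ⟨-s, h1.mono (by simp [Left.sign_neg]), h2.mono (by simp [Left.sign_neg])⟩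

lemma neg_transfer {Z : Finset (ℝ × ℝ)} {f g : ℝ[X]} (h : Pre Z f g) {x y : ℝ}
    (hxy : SP Z x y) (hx : ∀ p ∈ Z, p.1 ≠ x)
    (hI : ∀ t, SP Z t y → 0 < f.derivative.eval t) (hneg : f.eval x < 0) :
    ∃ y', SP Z x y' ∧ g.eval y' < 0 := by
  by_cases hA : ∃ p ∈ Z, p.1 < x
  · obtain ⟨p, hpA, hmax⟩ := Finset.exists_max_image (Z.filter fun p => p.1 < x) Prod.fst
      (by obtain ⟨p, hp, hpx⟩ := hA; exact ⟨p, by simp [hp, hpx]⟩)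
    simp only [Finset.mem_filter, and_imp] at hpA hmax
    obtain ⟨hp, hpx⟩ := hpA
    have hpy : p.2 < y := (hxy p hp).1.1 hpx
    have hle : ∀ q ∈ Z, q.2 < y → q.2 ≤ p.2 := by
      intro q hq hqy
      have := hmax q hq ((hxy q hq).1.2 hqy)
      exact not_lt.1 fun h' => absurd ((h.pi p hp q hq).2 h') (not_lt.2 this)
    have h1 : f.eval p.1 < 0 := by
      refine lt_trans (lt_of_deriv_pos f hpx fun t ht1 ht2 => hI t ?_) hneg
      intro q hq
      refine ⟨⟨fun h' => (hxy q hq).1.1 (h'.trans ht2), fun h' =>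
        (hmax q hq ((hxy q hq).1.2 h')).trans_lt ht1⟩, ⟨fun h' => ?_, fun h' =>
        ht2.trans ((hxy q hq).2.2 h')⟩⟩
      rcases lt_trichotomy q.1 x with h3 | h3 | h3
      · exact absurd (hmax q hq h3) (not_le.2 (ht1.trans h'))
      · exact absurd h3 (hx q hq)
      · exact (hxy q hq).2.1 h3
    have h2 : g.eval p.2 < 0 := by
      have := h.sgn p hp
      rw [sign_neg h1, eq_comm, sign_eq_neg_one_iff] at this
      exact this
    have h3 : ∀ᶠ s in 𝓝[>] p.2, g.eval s < 0 :=
      nhdsWithin_le_nhds ((g.continuous.tendsto p.2).eventually_lt_const h2)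
    obtain ⟨s, hs1, hs2⟩ := (h3.and (Ioo_mem_nhdsGT hpy)).exists
    refine ⟨s, ?_, hs1⟩
    intro q hq
    refine ⟨⟨fun h' => (hle q hq ((hxy q hq).1.1 h')).trans_lt hs2.1, fun h' =>
      (hxy q hq).1.2 (h'.trans hs2.2)⟩, ⟨fun h' => hs2.2.trans ((hxy q hq).2.1 h'), fun h' => ?_⟩⟩
    rcases lt_trichotomy q.1 x with h3 | h3 | h3
    · exact absurd (hle q hq ((hxy q hq).1.1 h3)) (not_le.2 (hs2.1.trans h'))
    · exact absurd h3 (hx q hq)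
    · exact h3
  · push Not at hA
    have hA' : ∀ p ∈ Z, x < p.1 := fun p hp => lt_of_le_of_ne (hA p hp) (hx p hp).symm
    have h1 : ∀ t < x, f.eval t < 0 := by
      intro t ht
      refine lt_trans (lt_of_deriv_pos f ht fun t _ ht2 => hI t ?_) hneg
      intro q hq
      have hq' := hA' q hq
      exact ⟨⟨fun h' => absurd h' (not_lt.2 (ht2.trans hq').le),
        fun h' => absurd h' (not_lt.2 ((hxy q hq).2.1 hq').le)⟩,
        ⟨fun _ => (hxy q hq).2.1 hq', fun _ => ht2.trans hq'⟩⟩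
    obtain ⟨s, hs1, hs2⟩ := h.bot
    have hs : s = -1 := by
      obtain ⟨t, ht, ht'⟩ := (hs1.and (eventually_lt_atBot x)).exists
      rw [← ht, sign_neg (h1 t ht')]
    obtain ⟨t, ht, ht'⟩ := (hs2.and (eventually_lt_atBot y)).exists
    rw [hs, sign_eq_neg_one_iff] at ht
    refine ⟨t, ?_, ht⟩
    intro q hq
    have hq' := hA' q hq
    have hq'' := (hxy q hq).2.1 hq'
    exact ⟨⟨fun h' => absurd h' (not_lt.2 hq'.le),
        fun h' => absurd h' (not_lt.2 (ht'.trans hq'').le)⟩,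
        ⟨fun _ => ht'.trans hq'', fun _ => hq'⟩⟩

lemma pos_transfer {Z : Finset (ℝ × ℝ)} {f g : ℝ[X]} (h : Pre Z f g) {x y : ℝ}
    (hxy : SP Z x y) (hx : ∀ p ∈ Z, p.1 ≠ x)
    (hI : ∀ t, SP Z t y → 0 < f.derivative.eval t) (hneg : 0 < f.eval x) :
    ∃ y', SP Z x y' ∧ 0 < g.eval y' := by
  by_cases hA : ∃ p ∈ Z, x < p.1
  · obtain ⟨p, hpA, hmax⟩ := Finset.exists_min_image (Z.filter fun p => x < p.1) Prod.fst
      (by obtain ⟨p, hp, hpx⟩ := hA; exact ⟨p, by simp [hp, hpx]⟩)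
    simp only [Finset.mem_filter, and_imp] at hpA hmax
    obtain ⟨hp, hpx⟩ := hpA
    have hpy : y < p.2 := (hxy p hp).2.1 hpx
    have hle : ∀ q ∈ Z, y < q.2 → p.2 ≤ q.2 := by
      intro q hq hqy
      have := hmax q hq ((hxy q hq).2.2 hqy)
      exact not_lt.1 fun h' => absurd ((h.pi q hq p hp).2 h') (not_lt.2 this)
    have h1 : 0 < f.eval p.1 := by
      refine lt_trans hneg (lt_of_deriv_pos f hpx fun t ht1 ht2 => hI t ?_)
      intro q hq
      refine ⟨⟨fun h' => ?_, fun h' =>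
        ((hxy q hq).1.2 h').trans ht1⟩, ⟨fun h' => (hxy q hq).2.1 (ht1.trans h'), fun h' =>
        ht2.trans_le (hmax q hq ((hxy q hq).2.2 h'))⟩⟩
      rcases lt_trichotomy q.1 x with h3 | h3 | h3
      · exact (hxy q hq).1.1 h3
      · exact absurd h3 (hx q hq)
      · exact absurd (hmax q hq h3) (not_le.2 (h'.trans ht2))
    have h2 : 0 < g.eval p.2 := by
      have := h.sgn p hp
      rw [sign_pos h1, eq_comm, sign_eq_one_iff] at this
      exact this
    have h3 : ∀ᶠ s in 𝓝[<] p.2, 0 < g.eval s :=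
      nhdsWithin_le_nhds ((g.continuous.tendsto p.2).eventually_const_lt h2)
    obtain ⟨s, hs1, hs2⟩ := (h3.and (Ioo_mem_nhdsLT hpy)).exists
    refine ⟨s, ?_, hs1⟩
    intro q hq
    refine ⟨⟨fun h' => ((hxy q hq).1.1 h').trans hs2.1, fun h' => ?_⟩,
      ⟨fun h' => hs2.2.trans_le (hle q hq ((hxy q hq).2.1 h')),
      fun h' => (hxy q hq).2.2 (hs2.1.trans h')⟩⟩
    rcases lt_trichotomy q.1 x with h3 | h3 | h3
    · exact h3
    · exact absurd h3 (hx q hq)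
    · exact absurd (hle q hq ((hxy q hq).2.1 h3)) (not_le.2 (h'.trans hs2.2))
  · push Not at hA
    have hA' : ∀ p ∈ Z, p.1 < x := fun p hp => lt_of_le_of_ne (hA p hp) (hx p hp)
    have h1 : ∀ t, x < t → 0 < f.eval t := by
      intro t ht
      refine lt_trans hneg (lt_of_deriv_pos f ht fun t ht2 _ => hI t ?_)
      intro q hq
      have hq' := hA' q hq
      exact ⟨⟨fun _ => (hxy q hq).1.1 hq', fun _ => hq'.trans ht2⟩,
        ⟨fun h' => absurd h' (not_lt.2 (hq'.trans ht2).le),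
        fun h' => absurd h' (not_lt.2 ((hxy q hq).1.1 hq').le)⟩⟩
    obtain ⟨s, hs1, hs2⟩ := h.top
    have hs : s = 1 := by
      obtain ⟨t, ht, ht'⟩ := (hs1.and (eventually_gt_atTop x)).exists
      rw [← ht, sign_pos (h1 t ht')]
    obtain ⟨t, ht, ht'⟩ := (hs2.and (eventually_gt_atTop y)).exists
    rw [hs, sign_eq_one_iff] at ht
    refine ⟨t, ?_, ht⟩
    intro q hq
    have hq' := hA' q hq
    have hq'' := (hxy q hq).1.1 hq'
    exact ⟨⟨fun _ => hq''.trans ht', fun _ => hq'⟩,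
      ⟨fun h' => absurd h' (not_lt.2 hq'.le),
        fun h' => absurd h' (not_lt.2 (hq''.trans ht').le)⟩⟩

lemma exists_near {Z : Finset (ℝ × ℝ)} {x y : ℝ} (hxy : SP Z x y) (hx : ∀ p ∈ Z, p.1 ≠ x) :
    ∀ᶠ t in 𝓝 x, SP Z t y := by
  have : ∀ p ∈ Z, ∀ᶠ t in 𝓝 x, (p.1 < t ↔ p.2 < y) ∧ (t < p.1 ↔ y < p.2) := by
    intro p hp
    have h := hxy p hp
    rcases lt_or_gt_of_ne (hx p hp) with h3 | h3
    · filter_upwards [lt_mem_nhds h3] with t ht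
      exact ⟨iff_of_true ht (h.1.1 h3), iff_of_false ht.le.not_gt (h.1.1 h3).le.not_gt⟩
    · filter_upwards [gt_mem_nhds h3] with t ht
      exact ⟨iff_of_false ht.le.not_gt (h.2.1 h3).le.not_gt, iff_of_true ht (h.2.1 h3)⟩
  exact (Finset.eventually_all Z).2 this

lemma zero_pert {Z : Finset (ℝ × ℝ)} {f : ℝ[X]} {x y : ℝ}
    (hxy : SP Z x y) (hx : ∀ p ∈ Z, p.1 ≠ x)
    (hI : ∀ t, SP Z t y → 0 < f.derivative.eval t) (h0 : f.eval x = 0) :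
    (∃ t, SP Z t y ∧ f.eval t < 0) ∧ (∃ t, SP Z t y ∧ 0 < f.eval t) := by
  have h := exists_near hxy hx
  constructor
  · obtain ⟨t, ht, ht'⟩ := ((h.filter_mono nhdsWithin_le_nhds : ∀ᶠ t in 𝓝[<] x, SP Z t y).and
      self_mem_nhdsWithin).exists
    refine ⟨t, ht, ?_⟩
    rw [← h0]
    exact lt_of_deriv_pos f ht' fun s h1 h2 => hI s (ht.convex hxy h1.le h2.le)
  · obtain ⟨t, ht, ht'⟩ := ((h.filter_mono nhdsWithin_le_nhds : ∀ᶠ t in 𝓝[>] x, SP Z t y).and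
      self_mem_nhdsWithin).exists
    refine ⟨t, ht, ?_⟩
    rw [← h0]
    exact lt_of_deriv_pos f ht' fun s h1 h2 => hI s (hxy.convex ht h1.le h2.le)

lemma ivt {Z : Finset (ℝ × ℝ)} {f : ℝ[X]} {y : ℝ}
    (h1 : ∃ t, SP Z t y ∧ f.eval t < 0) (h2 : ∃ t, SP Z t y ∧ 0 < f.eval t) :
    ∃ t, SP Z t y ∧ f.eval t = 0 := by
  obtain ⟨u, hu, hu'⟩ := h1
  obtain ⟨v, hv, hv'⟩ := h2
  have := intermediate_value_uIcc (f := fun x => f.eval x) (a := u) (b := v)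
    f.continuous.continuousOn
  obtain ⟨t, ht, ht'⟩ := this (Set.mem_uIcc.2 (Or.inl ⟨hu'.le, hv'.le⟩) : (0:ℝ) ∈ _)
  refine ⟨t, ?_, ht'⟩
  rcases Set.mem_uIcc.1 ht with h | h
  · exact hu.convex hv h.1 h.2
  · exact hv.convex hu h.1 h.2

lemma mismatch_inc {Z : Finset (ℝ × ℝ)} {f g : ℝ[X]} (h : Pre Z f g) {x y : ℝ}
    (hxy : SP Z x y) (hx : ∀ p ∈ Z, p.1 ≠ x)
    (hI : ∀ t, SP Z t y → 0 < f.derivative.eval t)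
    (hJ : ∀ t, SP Z x t → 0 < g.derivative.eval t)
    (hne : SignType.sign (f.eval x) ≠ SignType.sign (g.eval y)) :
    ∃ x0 y0, SP Z x0 y ∧ SP Z x y0 ∧ f.eval x0 = 0 ∧ g.eval y0 = 0 := by
  have hx' : ∀ t, SP Z t y → ∀ p ∈ Z, p.1 ≠ t := by
    intro t ht p hp e
    exact hx p hp ((hxy.eq_iff hp).2 ((ht.eq_iff hp).1 e))
  have hy' : ∀ t, SP Z x t → ∀ p ∈ swp Z, p.1 ≠ t := by
    intro t ht p hp e
    exact hx _ (mem_swp.1 hp) ((ht.eq_iff (mem_swp.1 hp)).2 e)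
  have n1 : (∃ t, SP Z t y ∧ f.eval t < 0) → ∃ t, SP Z x t ∧ g.eval t < 0 := by
    rintro ⟨t, ht, hn⟩
    obtain ⟨s, hs, hs'⟩ := neg_transfer h ht (hx' t ht) hI hn
    exact ⟨s, ht.trans hxy hs, hs'⟩
  have p1 : (∃ t, SP Z t y ∧ 0 < f.eval t) → ∃ t, SP Z x t ∧ 0 < g.eval t := by
    rintro ⟨t, ht, hn⟩
    obtain ⟨s, hs, hs'⟩ := pos_transfer h ht (hx' t ht) hI hn
    exact ⟨s, ht.trans hxy hs, hs'⟩
  have n2 : (∃ t, SP Z x t ∧ g.eval t < 0) → ∃ t, SP Z t y ∧ f.eval t < 0 := by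
    rintro ⟨t, ht, hn⟩
    obtain ⟨s, hs, hs'⟩ := neg_transfer h.swp ht.swp (hy' t ht) (fun t ht => hJ t ht.of_swp) hn
    exact ⟨s, ht.trans hs.of_swp hxy, hs'⟩
  have p2 : (∃ t, SP Z x t ∧ 0 < g.eval t) → ∃ t, SP Z t y ∧ 0 < f.eval t := by
    rintro ⟨t, ht, hn⟩
    obtain ⟨s, hs, hs'⟩ := pos_transfer h.swp ht.swp (hy' t ht) (fun t ht => hJ t ht.of_swp) hn
    exact ⟨s, ht.trans hs.of_swp hxy, hs'⟩
  have both : (∃ t, SP Z t y ∧ f.eval t < 0) ∧ (∃ t, SP Z t y ∧ 0 < f.eval t) := by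
    have zf := zero_pert hxy hx hI
    have zg : g.eval y = 0 → _ :=
      zero_pert hxy.swp (hy' y hxy) (fun t ht => hJ t ht.of_swp)
    have zg' : g.eval y = 0 →
        (∃ t, SP Z x t ∧ g.eval t < 0) ∧ (∃ t, SP Z x t ∧ 0 < g.eval t) := by
      intro h0
      obtain ⟨⟨a, ha, ha'⟩, ⟨b, hb, hb'⟩⟩ := zg h0
      exact ⟨⟨a, ha.of_swp, ha'⟩, ⟨b, hb.of_swp, hb'⟩⟩
    rcases lt_trichotomy (f.eval x) 0 with hf | hf | hf
    · rcases lt_trichotomy (g.eval y) 0 with hg | hg | hg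
      · exact absurd (by rw [sign_neg hf, sign_neg hg]) hne
      · exact ⟨n2 (zg' hg).1, p2 (zg' hg).2⟩
      · exact ⟨⟨x, hxy, hf⟩, p2 ⟨y, hxy, hg⟩⟩
    · exact zf hf
    · rcases lt_trichotomy (g.eval y) 0 with hg | hg | hg
      · exact ⟨n2 ⟨y, hxy, hg⟩, ⟨x, hxy, hf⟩⟩
      · exact ⟨n2 (zg' hg).1, p2 (zg' hg).2⟩
      · exact absurd (by rw [sign_pos hf, sign_pos hg]) hne
  obtain ⟨x0, hx0, hx0'⟩ := ivt both.1 both.2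
  obtain ⟨a, ha, ha'⟩ := n1 both.1
  obtain ⟨b, hb, hb'⟩ := p1 both.2
  obtain ⟨y0, hy0, hy0'⟩ := ivt ⟨a, ha.swp, ha'⟩ ⟨b, hb.swp, hb'⟩
  exact ⟨x0, y0, hx0, hy0.of_swp, hx0', hy0'⟩

lemma agree_inc {Z : Finset (ℝ × ℝ)} {f g : ℝ[X]} {x y : ℝ} (hxy : SP Z x y)
    (hI : ∀ t, SP Z t y → 0 < f.derivative.eval t)
    (hJ : ∀ t, SP Z x t → 0 < g.derivative.eval t) {x0 y0 : ℝ}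
    (hx0 : SP Z x0 y) (hy0 : SP Z x y0) (hf : f.eval x0 = 0) (hg : g.eval y0 = 0)
    (h1 : x0 < x ↔ y0 < y) (h2 : x < x0 ↔ y < y0) :
    SignType.sign (f.eval x) = SignType.sign (g.eval y) := by
  rcases lt_trichotomy x0 x with h | h | h
  · rw [sign_pos, sign_pos]
    · rw [← hg]
      exact lt_of_deriv_pos g (h1.1 h) fun s a b => hJ s (hy0.swp.convex hxy.swp a.le b.le).of_swp
    · rw [← hf]
      exact lt_of_deriv_pos f h fun s a b => hI s (hx0.convex hxy a.le b.le)
  · have : y = y0 := le_antisymm (not_lt.1 fun h' => by simpa [h] using h1.2 h')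
      (not_lt.1 fun h' => by simpa [h] using h2.2 h')
    rw [this, hg, ← h, hf]
  · rw [sign_neg, sign_neg]
    · rw [← hg]
      exact lt_of_deriv_pos g (h2.1 h) fun s a b => hJ s (hxy.swp.convex hy0.swp a.le b.le).of_swp
    · rw [← hf]
      exact lt_of_deriv_pos f h fun s a b => hI s (hxy.convex hx0 a.le b.le)

end TS

namespace TS

/-- `Z` is a root chart for the set `L` of pairs of polynomials. -/
structure IsChart (L : Set (ℝ[X] × ℝ[X])) (Z : Finset (ℝ × ℝ)) : Prop where
  pi : PI Z
  root_of : ∀ p ∈ Z, ∃ q ∈ L, q.1 ≠ 0 ∧ q.2 ≠ 0 ∧ q.1.eval p.1 = 0 ∧ q.2.eval p.2 = 0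
  mem1 : ∀ q ∈ L, q.1 ≠ 0 → ∀ x, q.1.eval x = 0 → ∃ p ∈ Z, p.1 = x
  mem2 : ∀ q ∈ L, q.2 ≠ 0 → ∀ x, q.2.eval x = 0 → ∃ p ∈ Z, p.2 = x
  zero : ∀ q ∈ L, q.1 = 0 ↔ q.2 = 0
  sgn : ∀ x y, SP Z x y → ∀ q ∈ L, SignType.sign (q.1.eval x) = SignType.sign (q.2.eval y)

lemma sign_eq_of_no_root (f : ℝ[X]) {u v : ℝ} (huv : u ≤ v)
    (h : ∀ t, u ≤ t → t ≤ v → f.eval t ≠ 0) :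
    SignType.sign (f.eval u) = SignType.sign (f.eval v) := by
  rcases lt_or_gt_of_ne (h u le_rfl huv) with h1 | h1 <;>
  rcases lt_or_gt_of_ne (h v huv le_rfl) with h2 | h2
  · rw [sign_neg h1, sign_neg h2]
  · obtain ⟨t, ht, ht'⟩ := intermediate_value_Icc (f := fun x => f.eval x) huv
      f.continuous.continuousOn (Set.mem_Icc.2 ⟨h1.le, h2.le⟩ : (0 : ℝ) ∈ _)
    exact absurd ht' (h t ht.1 ht.2)
  · obtain ⟨t, ht, ht'⟩ := intermediate_value_Icc' (f := fun x => f.eval x) huv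
      f.continuous.continuousOn (Set.mem_Icc.2 ⟨h2.le, h1.le⟩ : (0 : ℝ) ∈ _)
    exact absurd ht' (h t ht.1 ht.2)
  · rw [sign_pos h1, sign_pos h2]

open Classical in
lemma IsChart.restrict {L L0 : Set (ℝ[X] × ℝ[X])} {Z : Finset (ℝ × ℝ)} (h : IsChart L Z)
    (hL : L0 ⊆ L) : ∃ Z0 ⊆ Z, IsChart L0 Z0 := by
  refine ⟨Z.filter fun p => ∃ q ∈ L0, q.1 ≠ 0 ∧ q.2 ≠ 0 ∧ q.1.eval p.1 = 0 ∧ q.2.eval p.2 = 0,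
    Finset.filter_subset _ _, ?_⟩
  have key : ∀ q ∈ L0, q.1 ≠ 0 → ∀ p ∈ Z, q.1.eval p.1 = 0 ∨ q.2.eval p.2 = 0 → ∃ q ∈ L0, q.1 ≠ 0 ∧ q.2 ≠ 0 ∧
      q.1.eval p.1 = 0 ∧ q.2.eval p.2 = 0 := by
    intro q hq hq0 p hp hr
    have hs := h.sgn _ _ (SP.of_mem h.pi hp) q (hL hq)
    have : q.1.eval p.1 = 0 ↔ q.2.eval p.2 = 0 := by
      rw [← sign_eq_zero_iff, hs, sign_eq_zero_iff]
    refine ⟨q, hq, hq0, fun h0 => hq0 ((h.zero q (hL hq)).2 h0), ?_, ?_⟩ <;> tauto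
  refine ⟨?_, ?_, ?_, ?_, ?_, ?_⟩
  · intro p hp q hq
    exact h.pi p (Finset.mem_filter.1 hp).1 q (Finset.mem_filter.1 hq).1
  · intro p hp
    exact (Finset.mem_filter.1 hp).2
  · intro q hq hq0 x hx
    obtain ⟨p, hp, rfl⟩ := h.mem1 q (hL hq) hq0 x hx
    exact ⟨p, Finset.mem_filter.2 ⟨hp, key q hq hq0 p hp (Or.inl hx)⟩, rfl⟩
  · intro q hq hq0 x hx
    obtain ⟨p, hp, rfl⟩ := h.mem2 q (hL hq) hq0 x hx
    exact ⟨p, Finset.mem_filter.2 ⟨hp, key q hq (fun h0 => hq0 ((h.zero q (hL hq)).1 h0)) p hp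
      (Or.inr hx)⟩, rfl⟩
  · intro q hq
    exact h.zero q (hL hq)
  · intro x y hxy q hq
    by_cases hq0 : q.1 = 0
    · rw [hq0, (h.zero q (hL hq)).1 hq0]; simp
    obtain ⟨y', hy'⟩ := exists_SP h.pi x
    rw [h.sgn x y' hy' q (hL hq)]
    have hroot : ∀ t, q.2.eval t = 0 → (t < y' ↔ t < y) ∧ (y' < t ↔ y < t) := by
      intro t ht
      obtain ⟨p, hp, rfl⟩ := h.mem2 q (hL hq) (fun h0 => hq0 ((h.zero q (hL hq)).2 h0)) t ht
      have hp' := hxy p (Finset.mem_filter.2 ⟨hp, key q hq hq0 p hp (Or.inr ht)⟩)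
      have := hy' p hp
      exact ⟨this.1.symm.trans hp'.1, this.2.symm.trans hp'.2⟩
    rcases lt_trichotomy y' y with h1 | h1 | h1
    · apply sign_eq_of_no_root _ h1.le
      intro t ht1 ht2 ht0
      have := hroot t ht0
      grind
    · rw [h1]
    · symm
      apply sign_eq_of_no_root _ h1.le
      intro t ht1 ht2 ht0
      have := hroot t ht0
      grind

lemma dicho {L : Set (ℝ[X] × ℝ[X])} {Z : Finset (ℝ × ℝ)} (h : IsChart L Z) {f g : ℝ[X]}
    (hd : (derivative f, derivative g) ∈ L) (hf' : derivative f ≠ 0) {x y : ℝ}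
    (hxy : SP Z x y) (hx : ∀ p ∈ Z, p.1 ≠ x) :
    ((∀ t, SP Z t y → 0 < f.derivative.eval t) ∧ (∀ t, SP Z x t → 0 < g.derivative.eval t)) ∨
    ((∀ t, SP Z t y → 0 < (-f).derivative.eval t) ∧
      (∀ t, SP Z x t → 0 < (-g).derivative.eval t)) := by
  have h0 : f.derivative.eval x ≠ 0 := by
    intro h0
    obtain ⟨p, hp, hp'⟩ := h.mem1 _ hd hf' x h0
    exact hx p hp hp'
  have e0 := h.sgn x y hxy _ hd
  simp only at e0
  rcases lt_or_gt_of_ne h0 with h1 | h1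
  · right
    rw [sign_neg h1] at e0
    constructor
    · intro t ht
      have := h.sgn t y ht _ hd
      simp only at this
      rw [← e0, sign_eq_neg_one_iff] at this
      simpa using this
    · intro t ht
      have := h.sgn x t ht _ hd
      simp only at this
      rw [sign_neg h1, eq_comm, sign_eq_neg_one_iff] at this
      simpa using this
  · left
    rw [sign_pos h1] at e0
    constructor
    · intro t ht
      have := h.sgn t y ht _ hd
      simp only at this
      rwa [← e0, sign_eq_one_iff] at this
    · intro t ht
      have := h.sgn x t ht _ hd
      simp only at this
      rwa [sign_pos h1, eq_comm, sign_eq_one_iff] at this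

lemma mismatch {L : Set (ℝ[X] × ℝ[X])} {Z : Finset (ℝ × ℝ)} (h : IsChart L Z) {f g : ℝ[X]}
    (hd : (derivative f, derivative g) ∈ L) (hf' : derivative f ≠ 0) (hp : Pre Z f g) {x y : ℝ}
    (hxy : SP Z x y) (hx : ∀ p ∈ Z, p.1 ≠ x)
    (hne : SignType.sign (f.eval x) ≠ SignType.sign (g.eval y)) :
    ∃ x0 y0, SP Z x0 y ∧ SP Z x y0 ∧ f.eval x0 = 0 ∧ g.eval y0 = 0 := by
  rcases dicho h hd hf' hxy hx with ⟨h1, h2⟩ | ⟨h1, h2⟩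
  · exact mismatch_inc hp hxy hx h1 h2 hne
  · simpa using mismatch_inc hp.neg hxy hx h1 h2 (by simpa [Left.sign_neg] using hne)

lemma agree {L : Set (ℝ[X] × ℝ[X])} {Z : Finset (ℝ × ℝ)} (h : IsChart L Z) {f g : ℝ[X]}
    (hd : (derivative f, derivative g) ∈ L) (hf' : derivative f ≠ 0) {x y : ℝ}
    (hxy : SP Z x y) (hx : ∀ p ∈ Z, p.1 ≠ x) {x0 y0 : ℝ}
    (hx0 : SP Z x0 y) (hy0 : SP Z x y0) (hf : f.eval x0 = 0) (hg : g.eval y0 = 0)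
    (h1 : x0 < x ↔ y0 < y) (h2 : x < x0 ↔ y < y0) :
    SignType.sign (f.eval x) = SignType.sign (g.eval y) := by
  rcases dicho h hd hf' hxy hx with ⟨i, j⟩ | ⟨i, j⟩
  · exact agree_inc hxy i j hx0 hy0 hf hg h1 h2
  · simpa [Left.sign_neg] using agree_inc hxy i j hx0 hy0 (by simpa using hf) (by simpa using hg) h1 h2

lemma inj_of_deriv (f : ℝ[X]) {Z : Finset (ℝ × ℝ)} {y x0 x1 : ℝ}
    (hI : ∀ t, SP Z t y → 0 < f.derivative.eval t) (h0 : SP Z x0 y) (h1 : SP Z x1 y)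
    (e : f.eval x0 = f.eval x1) : x0 = x1 := by
  rcases lt_trichotomy x0 x1 with h | h | h
  · exact absurd e (lt_of_deriv_pos f h fun t a b => hI t (h0.convex h1 a.le b.le)).ne
  · exact h
  · exact absurd e (lt_of_deriv_pos f h fun t a b => hI t (h1.convex h0 a.le b.le)).ne'

open Classical in
lemma key {L : Set (ℝ[X] × ℝ[X])} {Z : Finset (ℝ × ℝ)} (h : IsChart L Z) {f g : ℝ[X]}
    (hd : (derivative f, derivative g) ∈ L) (hf' : derivative f ≠ 0) (hp : Pre Z f g)
    (hf : f ≠ 0) (hg : g ≠ 0) : ∃ Z', IsChart (insert (f, g) L) Z' := by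
  set W := (f.roots.toFinset ×ˢ g.roots.toFinset).filter (fun p => SP Z p.1 p.2) with hW
  have memW : ∀ x y, (x, y) ∈ W ↔ f.eval x = 0 ∧ g.eval y = 0 ∧ SP Z x y := by
    intro x y
    simp [hW, hf, hg, and_assoc]
  refine ⟨Z ∪ W, ?_, ?_, ?_, ?_, ?_, ?_⟩
  · rintro ⟨x0, y0⟩ hp0 ⟨x1, y1⟩ hp1
    have s0 : SP Z x0 y0 := by
      rcases Finset.mem_union.1 hp0 with h0 | h0
      · exact SP.of_mem h.pi h0
      · exact ((memW _ _).1 h0).2.2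
    have s1 : SP Z x1 y1 := by
      rcases Finset.mem_union.1 hp1 with h0 | h0
      · exact SP.of_mem h.pi h0
      · exact ((memW _ _).1 h0).2.2
    rcases Finset.mem_union.1 hp0 with h0 | h0
    · exact (s1 _ h0).1
    rcases Finset.mem_union.1 hp1 with h1 | h1
    · exact (s0 _ h1).2
    rw [memW] at h0 h1
    by_cases s : SP Z x0 y1
    · by_cases hx : ∃ p ∈ Z, p.1 = x0
      · obtain ⟨p, hpZ, e⟩ := hx
        have e1 := (s0.eq_iff hpZ).1 e
        have e2 := (s.eq_iff hpZ).1 e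
        have e3 := (s1.eq_iff hpZ).2 e2
        simp [← e, ← e1, ← e2, ← e3]
      · push Not at hx
        have : x0 = x1 ∧ y0 = y1 := by
          rcases dicho h hd hf' s hx with ⟨i, j⟩ | ⟨i, j⟩
          · exact ⟨inj_of_deriv f i s s1 (h0.1.trans h1.1.symm),
              inj_of_deriv g (Z := swp Z) (fun t ht => j t ht.of_swp) s0.swp s.swp
                (h0.2.1.trans h1.2.1.symm)⟩
          · exact ⟨inj_of_deriv (-f) i s s1 (by simp [h0.1, h1.1]),
              inj_of_deriv (-g) (Z := swp Z) (fun t ht => j t ht.of_swp) s0.swp s.swp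
                (by simp [h0.2.1, h1.2.1])⟩
        simp [this.1, this.2]
    · unfold SP at s
      push Not at s
      obtain ⟨p, hpZ, s⟩ := s
      have a := s0 p hpZ
      have b := s1 p hpZ
      simp only
      by_cases c1 : p.1 < x0 <;> by_cases c2 : x0 < p.1 <;> by_cases c3 : p.1 < x1 <;>
        by_cases c4 : x1 < p.1 <;> grind
  · rintro ⟨x0, y0⟩ hp0
    rcases Finset.mem_union.1 hp0 with h0 | h0
    · obtain ⟨q, hq, hq'⟩ := h.root_of _ h0
      exact ⟨q, Set.mem_insert_of_mem _ hq, hq'⟩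
    · rw [memW] at h0
      exact ⟨_, Set.mem_insert _ _, hf, hg, h0.1, h0.2.1⟩
  · intro q hq hq0 x hx
    rcases hq with rfl | hq
    · simp only at hx
      by_cases hxZ : ∃ p ∈ Z, p.1 = x
      · obtain ⟨p, hpZ, e⟩ := hxZ
        exact ⟨p, Finset.mem_union_left _ hpZ, e⟩
      · push Not at hxZ
        obtain ⟨y, hy⟩ := exists_SP h.pi x
        by_cases hgy : g.eval y = 0
        · exact ⟨(x, y), Finset.mem_union_right _ ((memW _ _).2 ⟨hx, hgy, hy⟩), rfl⟩
        · obtain ⟨x0, y0, _, h2, _, h4⟩ := mismatch h hd hf' hp hy hxZ (by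
            rw [hx, sign_zero]; exact fun e => hgy (sign_eq_zero_iff.1 e.symm))
          exact ⟨(x, y0), Finset.mem_union_right _ ((memW _ _).2 ⟨hx, h4, h2⟩), rfl⟩
    · obtain ⟨p, hpZ, e⟩ := h.mem1 q hq hq0 x hx
      exact ⟨p, Finset.mem_union_left _ hpZ, e⟩
  · intro q hq hq0 y hy
    rcases hq with rfl | hq
    · simp only at hy
      obtain ⟨x, hxy⟩ := exists_SP' h.pi y
      by_cases hxZ : ∃ p ∈ Z, p.1 = x
      · obtain ⟨p, hpZ, e⟩ := hxZ
        exact ⟨p, Finset.mem_union_left _ hpZ, (hxy.eq_iff hpZ).1 e⟩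
      · push Not at hxZ
        by_cases hfx : f.eval x = 0
        · exact ⟨(x, y), Finset.mem_union_right _ ((memW _ _).2 ⟨hfx, hy, hxy⟩), rfl⟩
        · obtain ⟨x0, y0, h1, _, h3, _⟩ := mismatch h hd hf' hp hxy hxZ (by
            rw [hy, sign_zero]; exact fun e => hfx (sign_eq_zero_iff.1 e))
          exact ⟨(x0, y), Finset.mem_union_right _ ((memW _ _).2 ⟨h3, hy, h1⟩), rfl⟩
    · obtain ⟨p, hpZ, e⟩ := h.mem2 q hq hq0 y hy
      exact ⟨p, Finset.mem_union_left _ hpZ, e⟩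
  · intro q hq
    rcases hq with rfl | hq
    · simp [hf, hg]
    · exact h.zero q hq
  · intro x y hxy q hq
    have hs : SP Z x y := fun p hpZ => hxy p (Finset.mem_union_left _ hpZ)
    rcases hq with rfl | hq
    · simp only
      by_cases hxZ : ∃ p ∈ Z, p.1 = x
      · obtain ⟨p, hpZ, e⟩ := hxZ
        rw [← e, ← (hs.eq_iff hpZ).1 e]
        exact hp.sgn p hpZ
      · push Not at hxZ
        by_contra hne
        obtain ⟨x0, y0, h1, h2, h3, h4⟩ := mismatch h hd hf' hp hs hxZ hne
        have hm := hxy (x0, y0) (Finset.mem_union_right _ ((memW _ _).2 ⟨h3, h4, hs.trans h1 h2⟩))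
        exact hne (agree h hd hf' hs hxZ h1 h2 h3 h4 hm.1 hm.2)
    · exact h.sgn x y hs q hq

lemma sign_top (f : ℝ[X]) (hd : 0 < f.natDegree) :
    ∀ᶠ t in atTop, SignType.sign (f.eval t) = SignType.sign f.leadingCoeff := by
  have hf : f ≠ 0 := by rintro rfl; simp at hd
  have hd' : 0 < f.degree := natDegree_pos_iff_degree_pos.1 hd
  rcases lt_or_gt_of_ne (leadingCoeff_ne_zero.2 hf) with h | h
  · filter_upwards [(f.tendsto_atBot_of_leadingCoeff_nonpos hd' h.le).eventually_lt_atBot 0]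
      with t ht
    rw [sign_neg ht, sign_neg h]
  · filter_upwards [(f.tendsto_atTop_of_leadingCoeff_nonneg hd' h.le).eventually_gt_atTop 0]
      with t ht
    rw [sign_pos ht, sign_pos h]

lemma sign_bot (f : ℝ[X]) (hd : 0 < f.natDegree) :
    ∀ᶠ t in atBot, SignType.sign (f.eval t) =
      SignType.sign ((-1 : ℝ) ^ f.natDegree) * SignType.sign f.leadingCoeff := by
  have h := sign_top (f.comp (-X)) (by simpa [natDegree_comp] using hd)
  have h2 := tendsto_neg_atBot_atTop.eventually h
  filter_upwards [h2] with t ht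
  rw [← sign_mul]
  simpa [leadingCoeff_comp, mul_comm] using ht

lemma Pre.mk' {Z : Finset (ℝ × ℝ)} {f g : ℝ[X]} (hZ : PI Z)
    (hs : ∀ p ∈ Z, SignType.sign (f.eval p.1) = SignType.sign (g.eval p.2))
    (hd : 0 < f.natDegree) (he : f.natDegree = g.natDegree)
    (hl : SignType.sign f.leadingCoeff = SignType.sign g.leadingCoeff) : Pre Z f g where
  pi := hZ
  sgn := hs
  bot := ⟨_, sign_bot f hd, by rw [hl, he]; exact sign_bot g (he ▸ hd)⟩
  top := ⟨_, sign_top f hd, by rw [hl]; exact sign_top g (he ▸ hd)⟩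

end TS

namespace TS

/-- `a` and `b` give the same signs to all elements of `T`. -/
def SE {R : Type*} [CommRing R] (T : Set R) (a b : R →+* ℝ) : Prop :=
  ∀ t ∈ T, SignType.sign (a t) = SignType.sign (b t)

/-- Pairs of specialisations. -/
def pairs {R : Type*} [CommRing R] (F : Set R[X]) (a b : R →+* ℝ) : Set (ℝ[X] × ℝ[X]) :=
  (fun q => (q.map a, q.map b)) '' F

/-- The root chart of `F` is controlled by finitely many signs. -/
def Full {R : Type*} [CommRing R] (F : Set R[X]) : Prop :=
  ∃ T : Set R, T.Finite ∧ ∀ a b : R →+* ℝ, SE T a b → ∃ Z, IsChart (pairs F a b) Z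

lemma prem {R : Type*} [CommRing R] [IsDomain R] (q : R[X]) (hq : q ≠ 0) (n : ℕ) :
    ∀ f : R[X], f.degree < n → ∃ (k : ℕ) (s r : R[X]),
      C q.leadingCoeff ^ k * f = q * s + r ∧ r.degree < q.degree := by
  induction n with
  | zero =>
    intro f hf
    have : f = 0 := by
      rw [← degree_eq_bot]
      exact Nat.WithBot.lt_zero_iff.1 (by exact_mod_cast hf)
    exact ⟨0, 0, 0, by simp [this], by simpa [bot_lt_iff_ne_bot] using hq⟩
  | succ n ih =>
    intro f hf
    by_cases hlt : f.degree < q.degree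
    · exact ⟨0, 0, f, by simp, hlt⟩
    have hf0 : f ≠ 0 := by
      rintro rfl
      apply hlt
      simpa [bot_lt_iff_ne_bot] using hq
    have hle : q.natDegree ≤ f.natDegree := natDegree_le_natDegree (not_lt.1 hlt)
    have hlq : q.leadingCoeff ≠ 0 := leadingCoeff_ne_zero.2 hq
    have hlf : f.leadingCoeff ≠ 0 := leadingCoeff_ne_zero.2 hf0
    set g := C f.leadingCoeff * X ^ (f.natDegree - q.natDegree) * q with hg
    have hdeg : (C q.leadingCoeff * f - g).degree < f.degree := by
      have h1 : (C q.leadingCoeff * f).degree = f.degree := by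
        rw [degree_mul, degree_C hlq, zero_add]
      rw [← h1]
      apply degree_sub_lt_left
      · rw [h1, hg, degree_mul, degree_mul, degree_C hlf, degree_X_pow, zero_add,
          degree_eq_natDegree hq, degree_eq_natDegree hf0]
        norm_cast
        omega
      · exact mul_ne_zero (C_ne_zero.2 hlq) hf0
      · rw [hg, leadingCoeff_mul, leadingCoeff_mul, leadingCoeff_mul, leadingCoeff_C,
          leadingCoeff_C, leadingCoeff_X_pow, mul_one, mul_comm]
    obtain ⟨k, s, r, h1, h2⟩ := ih (C q.leadingCoeff * f - g) (by
      refine lt_of_lt_of_le hdeg ?_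
      rw [degree_eq_natDegree hf0] at hf ⊢
      norm_cast at hf ⊢
      omega)
    refine ⟨k + 1, s + C q.leadingCoeff ^ k * (C f.leadingCoeff * X ^ (f.natDegree - q.natDegree)),
      r, ?_, h2⟩
    rw [hg] at h1
    linear_combination h1

lemma map_eraseLead_of {R : Type*} [CommRing R] (q : R[X]) (a : R →+* ℝ)
    (h : a q.leadingCoeff = 0) : q.map a = q.eraseLead.map a := by
  have e := congrArg (Polynomial.map a) (eraseLead_add_monomial_natDegree_leadingCoeff q)
  rw [Polynomial.map_add, map_monomial, h, monomial_zero_right, add_zero] at e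
  exact e.symm

lemma sign_cancel : ∀ s u v : SignType, s ≠ 0 → s * u = s * v → u = v := by decide

lemma rem_sign {R : Type*} [CommRing R] [IsDomain R] (f : R[X]) (m : ℕ) (N : ℕ) :
    ∀ q : R[X], q.support.card < N → q.natDegree ≤ m + 1 →
    ∃ (P : Set R[X]) (T : Set R), P.Finite ∧ T.Finite ∧ (∀ r ∈ P, r.natDegree ≤ m) ∧
      ∀ a b : R →+* ℝ, SE T a b → q.map a ≠ 0 → ∀ z w : ℝ,
        (q.map a).eval z = 0 → (q.map b).eval w = 0 →
        (∀ r ∈ P, SignType.sign ((r.map a).eval z) = SignType.sign ((r.map b).eval w)) →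
        SignType.sign ((f.map a).eval z) = SignType.sign ((f.map b).eval w) := by
  induction N with
  | zero => intro q hq; omega
  | succ N ih =>
    intro q hq hqm
    by_cases hq0 : q = 0
    · refine ⟨∅, ∅, Set.finite_empty, Set.finite_empty, by simp, ?_⟩
      intro a b _ h
      simp [hq0] at h
    obtain ⟨P, T, hP, hT, hPm, H⟩ := ih q.eraseLead
      (by have := eraseLead_support_card_lt hq0; omega)
      (by have := eraseLead_natDegree_lt_or_eraseLead_eq_zero q
          rcases this with h | h
          · omega
          · simp [h])
    obtain ⟨k, s, r, h1, h2⟩ := prem q hq0 (f.natDegree + 1) f (by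
      refine lt_of_le_of_lt degree_le_natDegree ?_
      norm_cast
      omega)
    refine ⟨insert r P, insert q.leadingCoeff T, hP.insert _, hT.insert _, ?_, ?_⟩
    · intro r' hr'
      rcases hr' with rfl | hr'
      · by_cases hr0 : r' = 0
        · simp [hr0]
        · have := natDegree_lt_natDegree hr0 h2
          omega
      · exact hPm r' hr'
    · intro a b hab hqa z w hz hw hr
      have hc := hab q.leadingCoeff (Set.mem_insert _ _)
      by_cases hac : a q.leadingCoeff = 0
      · have hbc : b q.leadingCoeff = 0 := by
          rw [hac, sign_zero, eq_comm, sign_eq_zero_iff] at hc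
          exact hc
        rw [map_eraseLead_of q a hac] at hqa hz
        rw [map_eraseLead_of q b hbc] at hw
        exact H a b (fun t ht => hab t (Set.mem_insert_of_mem _ ht)) hqa z w hz hw
          (fun r hr' => hr r (Set.mem_insert_of_mem _ hr'))
      · have ea : (a q.leadingCoeff) ^ k * (f.map a).eval z = (r.map a).eval z := by
          have := congrArg (fun p => (p.map a).eval z) h1
          simpa [Polynomial.map_mul, Polynomial.map_pow, hz] using this
        have eb : (b q.leadingCoeff) ^ k * (f.map b).eval w = (r.map b).eval w := by
          have := congrArg (fun p => (p.map b).eval w) h1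
          simpa [Polynomial.map_mul, Polynomial.map_pow, hw] using this
        have hrr := hr r (Set.mem_insert _ _)
        rw [← ea, ← eb, sign_mul, sign_mul, sign_pow, sign_pow, ← hc] at hrr
        refine sign_cancel _ _ _ ?_ hrr
        rw [← sign_pow]
        intro h
        exact pow_ne_zero k hac (sign_eq_zero_iff.1 h)

lemma step {R : Type*} [CommRing R] [IsDomain R] (m : ℕ) (F : Set R[X]) (hF : F.Finite)
    (hFm : ∀ q ∈ F, q.natDegree ≤ m + 1) (f : R[X]) (hfm : f.natDegree = m + 1)
    (h1 : Full (insert f.eraseLead F))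
    (h2 : ∀ P : Set R[X], P.Finite → (∀ q ∈ P, q.natDegree ≤ m) → Full (F ∪ P)) :
    Full (insert f F) := by
  have hdm : (derivative f).natDegree ≤ m := by
    have := natDegree_derivative_le f
    omega
  have hF' : (insert (derivative f) F).Finite := hF.insert _
  have hF'm : ∀ q ∈ insert (derivative f) F, q.natDegree ≤ m + 1 := by
    rintro q (rfl | hq)
    · omega
    · exact hFm q hq
  have hrem : ∀ q : R[X], ∃ (P : Set R[X]) (T : Set R), P.Finite ∧ T.Finite ∧
      (∀ r ∈ P, r.natDegree ≤ m) ∧ (q ∈ insert (derivative f) F →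
      ∀ a b : R →+* ℝ, SE T a b → q.map a ≠ 0 → ∀ z w : ℝ,
        (q.map a).eval z = 0 → (q.map b).eval w = 0 →
        (∀ r ∈ P, SignType.sign ((r.map a).eval z) = SignType.sign ((r.map b).eval w)) →
        SignType.sign ((f.map a).eval z) = SignType.sign ((f.map b).eval w)) := by
    intro q
    by_cases hq : q ∈ insert (derivative f) F
    · obtain ⟨P, T, a, b, c, d⟩ := rem_sign f m _ q (Nat.lt_succ_self _) (hF'm q hq)
      exact ⟨P, T, a, b, c, fun _ => d⟩
    · exact ⟨∅, ∅, Set.finite_empty, Set.finite_empty, by simp, fun h => absurd h hq⟩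
  choose P T hP hT hPm hPT using hrem
  obtain ⟨T1, hT1, H1⟩ := h1
  obtain ⟨T2, hT2, H2⟩ := h2 (insert (derivative f) (⋃ q ∈ insert (derivative f) F, P q))
    ((hF'.biUnion fun q _ => hP q).insert _) (by
      rintro q (rfl | hq)
      · exact hdm
      · simp only [Set.mem_iUnion] at hq
        obtain ⟨q', _, hq'⟩ := hq
        exact hPm q' q hq')
  refine ⟨insert f.leadingCoeff (T1 ∪ T2 ∪ ⋃ q ∈ insert (derivative f) F, T q),
    ((hT1.union hT2).union (hF'.biUnion fun q _ => hT q)).insert _, ?_⟩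
  intro a b hab
  have hc := hab f.leadingCoeff (Set.mem_insert _ _)
  have hab1 : SE T1 a b := fun t ht => hab t (Or.inr (Or.inl (Or.inl ht)))
  have hab2 : SE T2 a b := fun t ht => hab t (Or.inr (Or.inl (Or.inr ht)))
  have hab3 : ∀ q ∈ insert (derivative f) F, SE (T q) a b := fun q hq t ht =>
    hab t (Or.inr (Or.inr (Set.mem_biUnion hq ht)))
  by_cases hac : a f.leadingCoeff = 0
  · have hbc : b f.leadingCoeff = 0 := by
      rw [hac, sign_zero, eq_comm, sign_eq_zero_iff] at hc
      exact hc
    obtain ⟨Z, hZ⟩ := H1 a b hab1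
    refine ⟨Z, ?_⟩
    have : pairs (insert f F) a b = pairs (insert f.eraseLead F) a b := by
      simp only [pairs, Set.image_insert_eq]
      rw [map_eraseLead_of f a hac, map_eraseLead_of f b hbc]
    rw [this]
    exact hZ
  · have hbc : b f.leadingCoeff ≠ 0 := by
      intro h
      rw [h, sign_zero, sign_eq_zero_iff] at hc
      exact hac hc
    obtain ⟨Z, hZ⟩ := H2 a b hab2
    obtain ⟨Z0, hZ0, hch⟩ := hZ.restrict (L0 := pairs (insert (derivative f) F) a b) (by
      apply Set.image_mono
      rintro q (rfl | hq)
      · exact Or.inr (Or.inl rfl)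
      · exact Or.inl hq)
    have da : (f.map a).natDegree = m + 1 := by rw [natDegree_map_of_leadingCoeff_ne_zero _ hac, hfm]
    have db : (f.map b).natDegree = m + 1 := by rw [natDegree_map_of_leadingCoeff_ne_zero _ hbc, hfm]
    have hpre : Pre Z0 (f.map a) (f.map b) := by
      refine Pre.mk' hch.pi ?_ (by omega) (by omega) ?_
      · intro p hp
        obtain ⟨_, ⟨q, hq, rfl⟩, n1, n2, r1, r2⟩ := hch.root_of p hp
        refine hPT q hq a b (hab3 q hq) n1 _ _ r1 r2 ?_
        intro r hr
        exact hZ.sgn _ _ (SP.of_mem hZ.pi (hZ0 hp)) (r.map a, r.map b)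
          ⟨r, Or.inr (Or.inr (Set.mem_biUnion hq hr)), rfl⟩
      · rw [leadingCoeff_map_of_leadingCoeff_ne_zero _ hac,
          leadingCoeff_map_of_leadingCoeff_ne_zero _ hbc, hc]
    obtain ⟨Z', hZ'⟩ := key hch (f := f.map a) (g := f.map b)
      ⟨derivative f, Or.inl rfl, by simp [derivative_map]⟩
      (by intro h; have := derivative_eq_zero.1 h; omega) hpre
      (by intro h; simp [h] at da) (by intro h; simp [h] at db)
    obtain ⟨Z1, _, hZ1⟩ := hZ'.restrict (L0 := pairs (insert f F) a b) (by
      rintro _ ⟨q, (rfl | hq), rfl⟩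
      · exact Or.inl rfl
      · exact Or.inr ⟨q, Or.inr hq, rfl⟩)
    exact ⟨Z1, hZ1⟩

lemma full_of_natDegree_le {R : Type*} [CommRing R] [IsDomain R] (m : ℕ) :
    ∀ G : Set R[X], G.Finite → (∀ q ∈ G, q.natDegree ≤ m) → Full G := by
  induction m with
  | zero =>
    intro G hG hd
    refine ⟨(fun q => q.coeff 0) '' G, hG.image _, fun a b hab => ⟨∅, ?_⟩⟩
    have hCa : ∀ q ∈ G, ∀ c : R →+* ℝ, q.map c = C (c (q.coeff 0)) := by
      intro q hq c
      conv_lhs => rw [eq_C_of_natDegree_le_zero (hd q hq)]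
      simp
    refine ⟨by simp [PI], by simp, ?_, ?_, ?_, ?_⟩
    · rintro _ ⟨q, hq, rfl⟩ h x hx
      simp only [hCa q hq, eval_C] at hx h
      simp [hx] at h
    · rintro _ ⟨q, hq, rfl⟩ h x hx
      simp only [hCa q hq, eval_C] at hx h
      simp [hx] at h
    · rintro _ ⟨q, hq, rfl⟩
      have := hab _ ⟨q, hq, rfl⟩
      simp only [hCa q hq, C_eq_zero]
      rw [← sign_eq_zero_iff, this, sign_eq_zero_iff]
    · rintro x y - _ ⟨q, hq, rfl⟩
      have := hab _ ⟨q, hq, rfl⟩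
      simpa only [hCa q hq, eval_C] using this
  | succ m ih =>
    have main : ∀ H : Set R[X], H.Finite → (∀ q ∈ H, q.natDegree ≤ m + 1) →
        ∀ G : Set R[X], G.Finite → (∀ q ∈ G, q.natDegree ≤ m) → Full (H ∪ G) := by
      intro H hH
      induction H, hH using Set.Finite.induction_on with
      | empty =>
        intro _ G hG hGm
        simpa using ih G hG hGm
      | @insert f H _ hH IH =>
        intro hHm G hG hGm
        have IH' := IH (fun q hq => hHm q (Or.inr hq))
        have hf := hHm f (Or.inl rfl)
        by_cases hfm : f.natDegree ≤ m
        · have := IH' (insert f G) (hG.insert _) (by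
            rintro q (rfl | hq)
            · exact hfm
            · exact hGm q hq)
          rwa [Set.union_insert, ← Set.insert_union] at this
        · rw [Set.insert_union]
          apply step m (H ∪ G) (hH.union hG) _ f (by omega)
          · rw [← Set.union_insert]
            apply IH' _ (hG.insert _)
            rintro q (rfl | hq)
            · have := eraseLead_natDegree_le f
              omega
            · exact hGm q hq
          · intro P hP hPm
            rw [Set.union_assoc]
            apply IH' _ (hG.union hP)
            rintro q (hq | hq)
            · exact hGm q hq
            · exact hPm q hq
          · rintro q (hq | hq)
            · exact hHm q (Or.inr hq)
            · have := hGm q hq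
              omega
    intro G hG hGm
    simpa using main G hG hGm ∅ Set.finite_empty (by simp)

lemma full {R : Type*} [CommRing R] [IsDomain R] (G : Set R[X]) (hG : G.Finite) : Full G := by
  obtain ⟨m, hm⟩ := (hG.image natDegree).bddAbove
  exact full_of_natDegree_le m G hG fun q hq => hm ⟨q, hq, rfl⟩

/-- Elimination of one variable. -/
lemma elim {R : Type*} [CommRing R] [IsDomain R] (G : Set R[X]) (hG : G.Finite) :
    ∃ T : Set R, T.Finite ∧ ∀ a b : R →+* ℝ, SE T a b → ∀ y, ∃ x, ∀ q ∈ G,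
      SignType.sign ((q.map a).eval x) = SignType.sign ((q.map b).eval y) := by
  obtain ⟨T, hT, H⟩ := full G hG
  refine ⟨T, hT, fun a b hab y => ?_⟩
  obtain ⟨Z, hZ⟩ := H a b hab
  obtain ⟨x, hx⟩ := exists_SP' hZ.pi y
  exact ⟨x, fun q hq => hZ.sgn x y hx _ ⟨q, hq, rfl⟩⟩

end TS

namespace TS

/-- Membership in `S` depends only on finitely many signs. -/
def SA {σ : Type*} (S : Set (σ → ℝ)) : Prop :=
  ∃ T : Set (MvPolynomial σ ℤ), T.Finite ∧ ∀ v w : σ → ℝ,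
    (∀ t ∈ T, SignType.sign (MvPolynomial.aeval v t) = SignType.sign (MvPolynomial.aeval w t)) →
    v ∈ S → w ∈ S

abbrev Lor := FirstOrder.Language.ring.sum FirstOrder.Language.order

lemma term_poly {β : Type*} (t : Lor.Term β) :
    ∃ P : MvPolynomial β ℤ, ∀ v : β → ℝ, MvPolynomial.aeval v P = t.realize v := by
  induction t with
  | var i => exact ⟨MvPolynomial.X i, fun v => by simp⟩
  | @func l f ts ih =>
    choose P hP using ih
    rcases f with f | f
    · cases f with
      | add => exact ⟨P 0 + P 1, fun v => by rw [map_add, hP, hP]; rfl⟩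
      | mul => exact ⟨P 0 * P 1, fun v => by rw [map_mul, hP, hP]; rfl⟩
      | neg => exact ⟨-P 0, fun v => by rw [map_neg, hP]; rfl⟩
      | zero => exact ⟨0, fun v => by rw [map_zero]; rfl⟩
      | one => exact ⟨1, fun v => by rw [map_one]; rfl⟩
    · exact isEmptyElim f

/-- Separate the last variable. -/
noncomputable def toPoly {α : Type*} {k : ℕ} :
    MvPolynomial (α ⊕ Fin (k + 1)) ℤ →ₐ[ℤ] (MvPolynomial (α ⊕ Fin k) ℤ)[X] :=
  MvPolynomial.aeval (Sum.elim (fun i => Polynomial.C (MvPolynomial.X (Sum.inl i)))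
    (Fin.snoc (α := fun _ => (MvPolynomial (α ⊕ Fin k) ℤ)[X])
      (fun j => Polynomial.C (MvPolynomial.X (Sum.inr j))) Polynomial.X))

lemma eval_toPoly {α : Type*} {k : ℕ} (v : α → ℝ) (xs : Fin k → ℝ) (x : ℝ)
    (P : MvPolynomial (α ⊕ Fin (k + 1)) ℤ) :
    ((toPoly P).map (MvPolynomial.aeval (Sum.elim v xs) :
      MvPolynomial (α ⊕ Fin k) ℤ →ₐ[ℤ] ℝ).toRingHom).eval x =
    MvPolynomial.aeval (Sum.elim v (Fin.snoc (α := fun _ => ℝ) xs x)) P := by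
  induction P using MvPolynomial.induction_on with
  | C a => simp [toPoly]
  | add p q hp hq => simp only [map_add, Polynomial.map_add, eval_add, hp, hq]
  | mul_X p i hp =>
    simp only [map_mul, Polynomial.map_mul, eval_mul, hp]
    congr 1
    rcases i with i | i
    · simp [toPoly]
    · refine Fin.lastCases ?_ (fun j => ?_) i
      · simp [toPoly]
      · simp [toPoly]

lemma formula_SA {α : Type*} {k : ℕ} (φ : Lor.BoundedFormula α k) :
    ∃ T : Set (MvPolynomial (α ⊕ Fin k) ℤ), T.Finite ∧ ∀ (v w : α → ℝ) (xs ys : Fin k → ℝ),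
      (∀ t ∈ T, SignType.sign (MvPolynomial.aeval (Sum.elim v xs) t) =
        SignType.sign (MvPolynomial.aeval (Sum.elim w ys) t)) →
      (φ.Realize v xs ↔ φ.Realize w ys) := by
  induction φ with
  | falsum => exact ⟨∅, Set.finite_empty, fun v w xs ys _ => Iff.rfl⟩
  | equal t₁ t₂ =>
    obtain ⟨P, hP⟩ := term_poly t₁
    obtain ⟨Q, hQ⟩ := term_poly t₂
    refine ⟨{P - Q}, Set.finite_singleton _, fun v w xs ys h => ?_⟩
    have h := h _ rfl
    simp only [map_sub (MvPolynomial.aeval _), hP, hQ] at h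
    change t₁.realize (Sum.elim v xs) = t₂.realize (Sum.elim v xs) ↔
      t₁.realize (Sum.elim w ys) = t₂.realize (Sum.elim w ys)
    rw [← sub_eq_zero, ← sign_eq_zero_iff, h, sign_eq_zero_iff, sub_eq_zero]
  | @rel k l R ts =>
    rcases R with R | R
    · exact isEmptyElim R
    · cases R
      obtain ⟨P, hP⟩ := term_poly (ts 0)
      obtain ⟨Q, hQ⟩ := term_poly (ts 1)
      refine ⟨{P - Q}, Set.finite_singleton _, fun v w xs ys h => ?_⟩
      have h := h _ rfl
      simp only [map_sub (MvPolynomial.aeval _), hP, hQ] at h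
      change (ts 0).realize (Sum.elim v xs) ≤ (ts 1).realize (Sum.elim v xs) ↔
        (ts 0).realize (Sum.elim w ys) ≤ (ts 1).realize (Sum.elim w ys)
      rw [← not_lt, ← not_lt, not_iff_not, ← sub_pos, ← sign_eq_one_iff, h, sign_eq_one_iff, sub_pos]
  | imp f₁ f₂ ih₁ ih₂ =>
    obtain ⟨T₁, h₁, H₁⟩ := ih₁
    obtain ⟨T₂, h₂, H₂⟩ := ih₂
    refine ⟨T₁ ∪ T₂, h₁.union h₂, fun v w xs ys h => ?_⟩
    rw [BoundedFormula.realize_imp, BoundedFormula.realize_imp,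
      H₁ v w xs ys (fun t ht => h t (Or.inl ht)), H₂ v w xs ys (fun t ht => h t (Or.inr ht))]
  | @all k f ih =>
    obtain ⟨T, hT, H⟩ := ih
    obtain ⟨T', hT', H'⟩ := elim (toPoly '' T) (hT.image _)
    have one : ∀ (v w : α → ℝ) (xs ys : Fin k → ℝ),
      (∀ t ∈ T', SignType.sign (MvPolynomial.aeval (Sum.elim v xs) t) =
        SignType.sign (MvPolynomial.aeval (Sum.elim w ys) t)) →
      (f.all.Realize v xs → f.all.Realize w ys) := by
      intro v w xs ys h hv
      rw [BoundedFormula.realize_all] at hv ⊢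
      intro y
      obtain ⟨x, hx⟩ := H' (MvPolynomial.aeval (Sum.elim v xs) :
        MvPolynomial (α ⊕ Fin k) ℤ →ₐ[ℤ] ℝ).toRingHom (MvPolynomial.aeval (Sum.elim w ys) :
        MvPolynomial (α ⊕ Fin k) ℤ →ₐ[ℤ] ℝ).toRingHom h y
      refine (H v w _ _ ?_).1 (hv x)
      intro t ht
      have := hx _ ⟨t, ht, rfl⟩
      rwa [eval_toPoly, eval_toPoly] at this
    exact ⟨T', hT', fun v w xs ys h => ⟨one v w xs ys h, one w v ys xs fun t ht => (h t ht).symm⟩⟩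

end TS

namespace TS

section bool
variable {α : Type*} {G : Set (Set α)}

lemma mba_inter {s t : Set α} (hs : MemBooleanAlgebraGen G s) (ht : MemBooleanAlgebraGen G t) :
    MemBooleanAlgebraGen G (s ∩ t) := by
  have := (hs.compl.union ht.compl).compl
  rwa [Set.compl_union, compl_compl, compl_compl] at this

lemma mba_empty : MemBooleanAlgebraGen G ∅ := by
  have := (MemBooleanAlgebraGen.univ (G := G)).compl
  rwa [Set.compl_univ] at this

lemma mba_biUnion {ι : Type*} {I : Set ι} (hI : I.Finite) (s : ι → Set α)
    (h : ∀ i ∈ I, MemBooleanAlgebraGen G (s i)) : MemBooleanAlgebraGen G (⋃ i ∈ I, s i) := by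
  induction I, hI using Set.Finite.induction_on with
  | empty => simpa using mba_empty
  | @insert a I _ _ ih =>
    rw [Set.biUnion_insert]
    exact (h a (Or.inl rfl)).union (ih fun i hi => h i (Or.inr hi))

lemma mba_biInter {ι : Type*} {I : Set ι} (hI : I.Finite) (s : ι → Set α)
    (h : ∀ i ∈ I, MemBooleanAlgebraGen G (s i)) : MemBooleanAlgebraGen G (⋂ i ∈ I, s i) := by
  have := (mba_biUnion hI (fun i => (s i)ᶜ) (fun i hi => (h i hi).compl)).compl
  simpa [Set.compl_iUnion] using this

end bool

/-- The generating family. -/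
def Gen (n : ℕ) : Set (Set (Fin n → ℝ)) :=
  ({t : Set (Fin n → ℝ) | ∃ P : MvPolynomial (Fin n) ℤ,
            t = {x | MvPolynomial.aeval x P = 0}} ∪
         {t : Set (Fin n → ℝ) | ∃ P : MvPolynomial (Fin n) ℤ,
            t = {x | 0 < MvPolynomial.aeval x P}})

lemma gen_sign {n : ℕ} (P : MvPolynomial (Fin n) ℤ) (s : SignType) :
    MemBooleanAlgebraGen (Gen n) {x | SignType.sign (MvPolynomial.aeval x P) = s} := by
  have h0 : MemBooleanAlgebraGen (Gen n) {x | MvPolynomial.aeval x P = 0} :=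
    .basic (Or.inl ⟨P, rfl⟩)
  have h1 : ∀ P : MvPolynomial (Fin n) ℤ,
      MemBooleanAlgebraGen (Gen n) {x | 0 < MvPolynomial.aeval x P} := fun P =>
    .basic (Or.inr ⟨P, rfl⟩)
  cases s with
  | zero => simpa only [SignType.zero_eq_zero, sign_eq_zero_iff] using h0
  | pos => simpa only [SignType.pos_eq_one, sign_eq_one_iff] using h1 P
  | neg => simpa only [SignType.neg_eq_neg_one, sign_eq_neg_one_iff, map_neg, Left.neg_pos_iff]
      using h1 (-P)

lemma mba_of_SA {n : ℕ} {S : Set (Fin n → ℝ)} (h : SA S) : MemBooleanAlgebraGen (Gen n) S := by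
  obtain ⟨T, hT, H⟩ := h
  have : Finite T := hT
  have e : S = ⋃ i ∈ {i : T → SignType | ∃ v ∈ S, ∀ t : T,
      SignType.sign (MvPolynomial.aeval v t.1) = i t}, ⋂ t ∈ (Set.univ : Set T),
      {x | SignType.sign (MvPolynomial.aeval x t.1) = i t} := by
    ext w
    simp only [Set.mem_iUnion, Set.mem_iInter, Set.mem_ofPred_eq, Set.mem_univ, true_implies]
    constructor
    · intro hw
      exact ⟨fun t => SignType.sign (MvPolynomial.aeval w t.1), ⟨w, hw, fun _ => rfl⟩, fun _ => rfl⟩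
    · rintro ⟨i, ⟨v, hv, hi⟩, hw⟩
      exact H v w (fun t ht => (hi ⟨t, ht⟩).trans (hw ⟨t, ht⟩).symm) hv
  rw [e]
  exact mba_biUnion (Set.toFinite _) _ fun i _ =>
    mba_biInter (Set.toFinite _) _ fun t _ => gen_sign t.1 (i t)

lemma poly_term {n : ℕ} (P : MvPolynomial (Fin n) ℤ) :
    ∃ t : Lor.Term (Fin n), ∀ v : Fin n → ℝ, t.realize v = MvPolynomial.aeval v P := by
  have hadd : ∀ s t : Lor.Term (Fin n), ∃ u : Lor.Term (Fin n), ∀ v : Fin n → ℝ,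
      u.realize v = s.realize v + t.realize v := fun s t =>
    ⟨.func (l := 2) (Sum.inl ringFunc.add) ![s, t], fun v => rfl⟩
  have hmul : ∀ s t : Lor.Term (Fin n), ∃ u : Lor.Term (Fin n), ∀ v : Fin n → ℝ,
      u.realize v = s.realize v * t.realize v := fun s t =>
    ⟨.func (l := 2) (Sum.inl ringFunc.mul) ![s, t], fun v => rfl⟩
  have hneg : ∀ s : Lor.Term (Fin n), ∃ u : Lor.Term (Fin n), ∀ v : Fin n → ℝ,
      u.realize v = - s.realize v := fun s =>
    ⟨.func (l := 1) (Sum.inl ringFunc.neg) ![s], fun v => rfl⟩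
  have hzero : ∃ u : Lor.Term (Fin n), ∀ v : Fin n → ℝ, u.realize v = 0 :=
    ⟨.func (l := 0) (Sum.inl ringFunc.zero) ![], fun v => rfl⟩
  have hone : ∃ u : Lor.Term (Fin n), ∀ v : Fin n → ℝ, u.realize v = 1 :=
    ⟨.func (l := 0) (Sum.inl ringFunc.one) ![], fun v => rfl⟩
  obtain ⟨o, ho⟩ := hone
  obtain ⟨o', ho'⟩ := hneg o
  induction P using MvPolynomial.induction_on with
  | C a =>
    induction a with
    | zero => simpa using hzero
    | succ i ih =>
      obtain ⟨t, ht⟩ := ih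
      obtain ⟨u, hu⟩ := hadd t o
      exact ⟨u, fun v => by rw [hu, ht, ho]; simp⟩
    | pred i ih =>
      obtain ⟨t, ht⟩ := ih
      obtain ⟨u, hu⟩ := hadd t o'
      exact ⟨u, fun v => by rw [hu, ht, ho', ho]; simp; ring⟩
  | add p q hp hq =>
    obtain ⟨t, ht⟩ := hp
    obtain ⟨s, hs⟩ := hq
    obtain ⟨u, hu⟩ := hadd t s
    exact ⟨u, fun v => by rw [hu, ht, hs, map_add]⟩
  | mul_X p i hp =>
    obtain ⟨t, ht⟩ := hp
    obtain ⟨u, hu⟩ := hmul t (.var i)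
    exact ⟨u, fun v => by rw [hu, ht, map_mul]; simp⟩

lemma definable_of_mba {n : ℕ} {S : Set (Fin n → ℝ)} (h : MemBooleanAlgebraGen (Gen n) S) :
    (∅ : Set ℝ).Definable Lor S := by
  obtain ⟨z, hz⟩ := poly_term (0 : MvPolynomial (Fin n) ℤ)
  induction h with
  | basic h =>
    rw [Set.empty_definable_iff]
    rcases h with ⟨P, rfl⟩ | ⟨P, rfl⟩
    · obtain ⟨t, ht⟩ := poly_term P
      refine ⟨Term.equal t z, ?_⟩
      ext x
      simp [Formula.realize_equal, ht, hz]
    · obtain ⟨t, ht⟩ := poly_term P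
      refine ⟨(Relations.formula₂ (L := Lor) (Sum.inr orderRel.le) t z).not, ?_⟩
      ext x
      let r : Lor.Relations 2 := Sum.inr orderRel.le
      have e : Formula.Realize (r.formula₂ t z) x ↔ t.realize x ≤ z.realize x :=
        Formula.realize_rel₂
      have e' : (0 < MvPolynomial.aeval x P) ↔ ¬ Formula.Realize (r.formula₂ t z) x := by
        rw [e, ht, hz]
        simp
      exact e'
  | univ => exact Set.definable_univ
  | compl _ ih => exact ih.compl
  | union _ _ ih1 ih2 => exact ih1.union ih2

end TS

/-- A set `S` of `n`-tuples of real numbers is definable without parameters in the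
language of ordered rings (the sum of the language of rings and the language of orders)
if and only if it belongs to the Boolean algebra of subsets of `Fin n → ℝ` generated by
the zero sets and positivity sets of polynomials with integer coefficients, i.e. iff it
is semialgebraic over the prime field. -/
theorem definable_iff_semialgebraic (n : ℕ) (S : Set (Fin n → ℝ)) :
    (∅ : Set ℝ).Definable (FirstOrder.Language.ring.sum FirstOrder.Language.order) S ↔
      MemBooleanAlgebraGen
        ({t : Set (Fin n → ℝ) | ∃ P : MvPolynomial (Fin n) ℤ,
            t = {x | MvPolynomial.aeval x P = 0}} ∪
         {t : Set (Fin n → ℝ) | ∃ P : MvPolynomial (Fin n) ℤ,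
            t = {x | 0 < MvPolynomial.aeval x P}}) S := by
  constructor
  · intro h
    rw [Set.empty_definable_iff] at h
    obtain ⟨φ, rfl⟩ := h
    apply TS.mba_of_SA
    obtain ⟨T, hT, H⟩ := TS.formula_SA φ
    refine ⟨MvPolynomial.rename (Sum.elim id Fin.elim0) '' T, hT.image _, fun v w h hv => ?_⟩
    have hv' : φ.Realize v := hv
    change φ.Realize w
    unfold Formula.Realize at hv' ⊢
    refine (H v w _ _ fun t ht => ?_).1 hv'
    have := h _ ⟨t, ht, rfl⟩
    rw [MvPolynomial.aeval_rename, MvPolynomial.aeval_rename] at this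
    have e : ∀ (u : Fin n → ℝ) (d : Fin 0 → ℝ),
        u ∘ Sum.elim id Fin.elim0 = Sum.elim u d := by
      intro u d
      funext i
      rcases i with i | i
      · rfl
      · exact i.elim0
    rw [← e v, ← e w]
    exact this
  · intro h
    exact TS.definable_of_mba h
end
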